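/- arXiv:1805.10237 — 9 statements merged into one kernel-verified Lean document; each statement's English description precedes it below -/
import Mathlib

section
/- For any 5 pairwise distinct points p₁,…,p₅ in the plane ℝ², there exist four pairwise distinct indices i, j, k, l ∈ {1,…,5} such that the closed segment joining p_i and p_j intersects the closed segment joining p_k and p_l (i.e., segment ℝ (p i) (p j) ∩ segment ℝ (p k) (p l) is nonempty). -/
/-- The vectors with at most `k` positive coordinates form a closed set. -/
lemma isClosed_setOf_card_pos_le {ι : Type*} [Fintype ι] (k : ℕ) :
    IsClosed {w : ι → ℝ | (Finset.univ.filter fun i => 0 < w i).card ≤ k} := by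
  have h : {w : ι → ℝ | (Finset.univ.filter fun i => 0 < w i).card ≤ k} =
      ⋃ S ∈ {S : Finset ι | S.card ≤ k}, ⋂ i ∈ {i | i ∉ S}, {w : ι → ℝ | w i ≤ 0} := by
    ext w
    simp only [Set.mem_ofPred_eq, Set.mem_iUnion, Set.mem_iInter, exists_prop]
    refine ⟨fun hw => ⟨_, hw, fun i hi => by simpa using hi⟩, ?_⟩
    rintro ⟨S, hS, hw⟩
    refine (Finset.card_le_card fun i hi => ?_).trans hS
    by_contra hiS
    exact absurd (Finset.mem_filter.1 hi).2 (hw i hiS).not_gt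
  rw [h]
  exact (Set.toFinite _).isClosed_biUnion fun S _ => isClosed_biInter fun i _ =>
    isClosed_le (continuous_apply i) continuous_const

/-- A subspace of dimension at least two of a space with at most `2 * k + 1` coordinates contains a
nonzero vector with at most `k` positive and at most `k` negative coordinates. -/
lemma Submodule.exists_ne_zero_card_pos_le_card_neg_le {ι : Type*} [Fintype ι] {k : ℕ}
    (hι : Fintype.card ι ≤ 2 * k + 1) (W : Submodule ℝ (ι → ℝ)) (hW : 1 < Module.finrank ℝ W) :
    ∃ w ∈ W, w ≠ 0 ∧ (Finset.univ.filter fun i => 0 < w i).card ≤ k ∧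
      (Finset.univ.filter fun i => w i < 0).card ≤ k := by
  classical
  let A : Set W := {w | (Finset.univ.filter fun i => 0 < w.1 i).card ≤ k}
  let B : Set W := {w | (Finset.univ.filter fun i => w.1 i < 0).card ≤ k}
  have hA : IsClosed A := (isClosed_setOf_card_pos_le k).preimage continuous_subtype_val
  have hneg : ∀ w : W, -w ∈ A ↔ w ∈ B := fun w => by simp [A, B]
  have hB : IsClosed B := by
    have : B = Neg.neg ⁻¹' A := Set.ext fun w => (hneg w).symm
    exact this ▸ hA.preimage continuous_neg
  have hAB : ∀ w : W, w ∈ A ∨ w ∈ B := fun w => by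
    have hd : Disjoint (Finset.univ.filter fun i => 0 < w.1 i)
        (Finset.univ.filter fun i => w.1 i < 0) :=
      Finset.disjoint_filter.2 fun i _ h => h.not_gt
    have h := (Finset.card_union_of_disjoint hd).symm.trans_le (Finset.card_le_univ _)
    simp only [A, B, Set.mem_ofPred_eq]
    omega
  have hconn : IsConnected ({0}ᶜ : Set W) :=
    isConnected_compl_singleton_of_one_lt_rank (Module.lt_rank_of_lt_finrank hW) 0
  obtain ⟨w, hw⟩ := hconn.nonempty
  have hw' : -w ∈ ({0}ᶜ : Set W) := by simpa using hw
  have hne : (({0}ᶜ : Set W) ∩ A).Nonempty ∧ (({0}ᶜ : Set W) ∩ B).Nonempty := by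
    rcases hAB w with h | h
    · exact ⟨⟨w, hw, h⟩, ⟨-w, hw', (hneg _).1 (by rwa [neg_neg])⟩⟩
    · exact ⟨⟨-w, hw', (hneg w).2 h⟩, ⟨w, hw, h⟩⟩
  obtain ⟨v, hv, hvA, hvB⟩ := isPreconnected_closed_iff.1 hconn.isPreconnected A B hA hB
    (fun v _ => hAB v) hne.1 hne.2
  exact ⟨v, v.2, by simpa using hv, hvA, hvB⟩

/-- If nonnegative multiples of `a, b` and of `c, d` have equal sums and equal positive total
weight, then the segments with ends `a, b` and `c, d` intersect. -/
lemma segment_inter_segment_nonempty {E : Type*} [AddCommGroup E] [Module ℝ E] {a b c d : E}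
    {α β γ δ : ℝ} (hα : 0 ≤ α) (hβ : 0 ≤ β) (hγ : 0 ≤ γ) (hδ : 0 ≤ δ) (hpos : 0 < α + β)
    (hsum : α + β = γ + δ) (h : α • a + β • b = γ • c + δ • d) :
    (segment ℝ a b ∩ segment ℝ c d).Nonempty := by
  refine ⟨(α + β)⁻¹ • (α • a + β • b), ?_, ?_⟩
  · refine ⟨(α + β)⁻¹ * α, (α + β)⁻¹ * β, by positivity, by positivity, ?_, ?_⟩
    · rw [← mul_add, inv_mul_cancel₀ hpos.ne']
    · simp [smul_smul]
  · rw [h]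
    refine ⟨(α + β)⁻¹ * γ, (α + β)⁻¹ * δ, by positivity, by positivity, ?_, ?_⟩
    · rw [← mul_add, ← hsum, inv_mul_cancel₀ hpos.ne']
    · simp [smul_smul]

/-- Linear non-planarity of `K₅`: from any 5 pairwise distinct points in the plane one
can choose two disjoint pairs such that the segment with ends at the first pair
intersects the segment with ends at the second pair. -/
theorem stmt_0 (p : Fin 5 → EuclideanSpace ℝ (Fin 2)) (hp : Function.Injective p) :
    ∃ i j k l : Fin 5, i ≠ j ∧ i ≠ k ∧ i ≠ l ∧ j ≠ k ∧ j ≠ l ∧ k ≠ l ∧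
      (segment ℝ (p i) (p j) ∩ segment ℝ (p k) (p l)).Nonempty := by
  let L : (Fin 5 → ℝ) →ₗ[ℝ] ℝ × EuclideanSpace ℝ (Fin 2) :=
    (Fintype.linearCombination ℝ fun _ => (1 : ℝ)).prod (Fintype.linearCombination ℝ p)
  have hker : 1 < Module.finrank ℝ (LinearMap.ker L) := by
    have h₁ := L.finrank_range_add_finrank_ker
    have h₂ := (LinearMap.range L).finrank_le
    simp only [Module.finrank_prod, Module.finrank_self, finrank_euclideanSpace,
      Module.finrank_fintype_fun_eq_card, Fintype.card_fin] at h₁ h₂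
    omega
  obtain ⟨w, hwL, hw0, hpos, hneg⟩ :=
    (LinearMap.ker L).exists_ne_zero_card_pos_le_card_neg_le (k := 2) (by simp) hker
  obtain ⟨hsum, hvec⟩ : ∑ i, w i = 0 ∧ ∑ i, w i • p i = 0 := by
    simpa [L, Fintype.linearCombination_apply] using hwL
  obtain ⟨S, hPS, hSN, hS⟩ := Finset.exists_subsuperset_card_eq
    (s := Finset.univ.filter fun i => 0 < w i) (t := (Finset.univ.filter fun i => w i < 0)ᶜ)
    (n := 2) (fun i hi => by simpa using (Finset.mem_filter.1 hi).2.le) hpos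
    (by rw [Finset.card_compl, Fintype.card_fin]; omega)
  obtain ⟨T, hNT, hTS, hT⟩ := Finset.exists_subsuperset_card_eq
    (s := Finset.univ.filter fun i => w i < 0) (t := Sᶜ)
    (n := 2) (Finset.subset_compl_comm.1 hSN) hneg
    (by rw [Finset.card_compl, Fintype.card_fin]; omega)
  have hS_nonneg : ∀ i ∈ S, 0 ≤ w i := fun i hi => by simpa using hSN hi
  have hS_nonpos : ∀ i ∉ S, w i ≤ 0 := fun i hi => by
    by_contra! h
    exact hi (hPS (by simpa using h))
  have hT_nonneg : ∀ i ∉ T, 0 ≤ w i := fun i hi => by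
    by_contra! h
    exact hi (hNT (by simpa using h))
  have hzero : ∀ i ∉ S ∪ T, w i = 0 := fun i hi => by
    rw [Finset.notMem_union] at hi
    exact le_antisymm (hS_nonpos i hi.1) (hT_nonneg i hi.2)
  have hdisj : Disjoint S T := (Finset.subset_compl_iff_disjoint_left.1 hTS)
  rw [← Finset.sum_subset (Finset.subset_univ (S ∪ T)) fun i _ hi => hzero i hi,
    Finset.sum_union hdisj] at hsum
  rw [← Finset.sum_subset (Finset.subset_univ (S ∪ T)) fun i _ hi => by
    rw [hzero i hi, zero_smul], Finset.sum_union hdisj] at hvec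
  obtain ⟨i, j, hij, rfl⟩ := Finset.card_eq_two.1 hS
  obtain ⟨k, l, hkl, rfl⟩ := Finset.card_eq_two.1 hT
  rw [Finset.sum_pair hij, Finset.sum_pair hkl] at hsum hvec
  have hi := hS_nonneg i (by simp)
  have hj := hS_nonneg j (by simp)
  simp only [Finset.disjoint_insert_left, Finset.disjoint_singleton_left, Finset.mem_insert,
    Finset.mem_singleton, not_or] at hdisj
  obtain ⟨⟨hik, hil⟩, hjk, hjl⟩ := hdisj
  have hk := hS_nonpos k (by simp [Ne.symm hik, Ne.symm hjk])
  have hl := hS_nonpos l (by simp [Ne.symm hil, Ne.symm hjl])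
  refine ⟨i, j, k, l, hij, hik, hil, hjk, hjl, hkl,
    segment_inter_segment_nonempty hi hj (neg_nonneg.2 hk) (neg_nonneg.2 hl) ?_
      (by linarith) ?_⟩
  · by_contra! h
    refine hw0 (funext fun m => ?_)
    by_cases hm : m ∈ ({i, j} ∪ {k, l} : Finset (Fin 5))
    · simp only [Finset.mem_union, Finset.mem_insert, Finset.mem_singleton] at hm
      rcases hm with (rfl | rfl) | rfl | rfl <;> simp only [Pi.zero_apply] <;> linarith
    · exact hzero m hm
  · rw [eq_neg_of_add_eq_zero_left hvec]
    simp only [neg_smul, neg_add]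
end

section
/- Let p₁,…,p₅ be 5 pairwise distinct points in the plane ℝ² such that no three of them are collinear. Then the set X = { x ∈ ℝ² : there exist two distinct unordered pairs {i,j} ≠ {k,l} of indices in {1,…,5} with x ∈ openSegment ℝ (p i) (p j) ∩ openSegment ℝ (p k) (p l) } of intersection points of interiors of the segments joining the 5 points is finite and has odd cardinality. -/
/-- Twice the signed area of the triangle `a b c`. -/
def signedArea (a b c : EuclideanSpace ℝ (Fin 2)) : ℝ :=
  (b 0 - a 0) * (c 1 - a 1) - (b 1 - a 1) * (c 0 - a 0)

theorem signedArea_rotate (a b c : EuclideanSpace ℝ (Fin 2)) :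
    signedArea b c a = signedArea a b c := by
  unfold signedArea; ring

theorem signedArea_swap (a b c : EuclideanSpace ℝ (Fin 2)) :
    signedArea b a c = -signedArea a b c := by
  unfold signedArea; ring

theorem signedArea_add_signedArea (a b c d : EuclideanSpace ℝ (Fin 2)) :
    signedArea b c d + signedArea a b d = signedArea a c d + signedArea a b c := by
  unfold signedArea; ring

theorem collinear_of_signedArea_eq_zero {a b c : EuclideanSpace ℝ (Fin 2)} (hab : a ≠ b)
    (h : signedArea a b c = 0) : Collinear ℝ ({a, b, c} : Set (EuclideanSpace ℝ (Fin 2))) := by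
  rw [collinear_iff_of_mem (p₀ := a) (by simp)]
  refine ⟨b - a, ?_⟩
  unfold signedArea at h
  suffices hc : ∃ r : ℝ, c = r • (b - a) +ᵥ a by
    rintro q (rfl | rfl | rfl)
    · exact ⟨0, by simp⟩
    · exact ⟨1, by simp⟩
    · exact hc
  by_cases h0 : b 0 - a 0 = 0
  · have h1 : b 1 - a 1 ≠ 0 := by
      intro h1
      apply hab
      ext i
      fin_cases i
      · exact (sub_eq_zero.mp h0).symm
      · exact (sub_eq_zero.mp h1).symm
    refine ⟨(c 1 - a 1) / (b 1 - a 1), ?_⟩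
    ext i
    fin_cases i
    · simp
      field_simp
      linear_combination -h
    · simp
      field_simp
      ring
  · refine ⟨(c 0 - a 0) / (b 0 - a 0), ?_⟩
    ext i
    fin_cases i
    · simp
      field_simp
      ring
    · simp
      field_simp
      linear_combination h

theorem exists_coords_of_mem_openSegment {a b x : EuclideanSpace ℝ (Fin 2)}
    (h : x ∈ openSegment ℝ a b) :
    ∃ s t : ℝ, 0 < s ∧ 0 < t ∧ s + t = 1 ∧ ∀ i, x i = s * a i + t * b i := by
  obtain ⟨s, t, hs, ht, hst, rfl⟩ := h
  exact ⟨s, t, hs, ht, hst, fun i => by simp⟩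

theorem signedArea_eq_zero_of_mem_openSegment {a b c x : EuclideanSpace ℝ (Fin 2)}
    (hb : x ∈ openSegment ℝ a b) (hc : x ∈ openSegment ℝ a c) : signedArea a b c = 0 := by
  obtain ⟨s, t, hs, ht, hst, hx⟩ := exists_coords_of_mem_openSegment hb
  obtain ⟨u, v, hu, hv, huv, hy⟩ := exists_coords_of_mem_openSegment hc
  obtain rfl : s = 1 - t := by linarith
  obtain rfl : u = 1 - v := by linarith
  have h0 := (hx 0).symm.trans (hy 0)
  have h1 := (hx 1).symm.trans (hy 1)
  refine (mul_eq_zero.mp ?_).resolve_left ht.ne'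
  unfold signedArea
  linear_combination (c 1 - a 1) * h0 - (c 0 - a 0) * h1

/-- The point `x` is a crossing of the open segments `a b` and `c d`. -/
def IsCrossing (x a b c d : EuclideanSpace ℝ (Fin 2)) : Prop :=
  x ∈ openSegment ℝ a b ∧ x ∈ openSegment ℝ c d

section Crossing

variable {a b c d x y : EuclideanSpace ℝ (Fin 2)}

theorem IsCrossing.symm (h : IsCrossing x a b c d) : IsCrossing x c d a b := ⟨h.2, h.1⟩

theorem IsCrossing.signedArea_mul_neg (h : IsCrossing x a b c d) (hc : signedArea a b c ≠ 0) :
    signedArea a b c * signedArea a b d < 0 := by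
  obtain ⟨s, t, hs, ht, hst, hx⟩ := exists_coords_of_mem_openSegment h.1
  obtain ⟨u, v, hu, hv, huv, hy⟩ := exists_coords_of_mem_openSegment h.2
  obtain rfl : s = 1 - t := by linarith
  obtain rfl : u = 1 - v := by linarith
  have h0 := (hx 0).symm.trans (hy 0)
  have h1 := (hx 1).symm.trans (hy 1)
  have key : (1 - v) * signedArea a b c + v * signedArea a b d = 0 := by
    unfold signedArea
    linear_combination (b 1 - a 1) * h0 - (b 0 - a 0) * h1
  have hpos : 0 < (1 - v) * signedArea a b c ^ 2 := by positivity
  refine neg_of_mul_neg_right (a := v) ?_ hv.le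
  linear_combination hpos + signedArea a b c * key

theorem exists_isCrossing (h₁ : signedArea a b c * signedArea a b d < 0)
    (h₂ : signedArea c d a * signedArea c d b < 0) : ∃ x, IsCrossing x a b c d := by
  have weights : ∀ X Y : ℝ, X * Y < 0 → 0 < Y / (Y - X) ∧ 0 < X / (X - Y) ∧
      Y / (Y - X) + X / (X - Y) = 1 := by
    intro X Y h
    have hne : Y - X ≠ 0 := by
      intro h0
      obtain rfl : Y = X := by linarith
      nlinarith [mul_self_nonneg Y]
    have hne' : X - Y ≠ 0 := by
      intro h0
      exact hne (by linarith)
    refine ⟨?_, ?_, ?_⟩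
    · rcases mul_neg_iff.mp h with ⟨hX, hY⟩ | ⟨hX, hY⟩
      · exact div_pos_of_neg_of_neg hY (by linarith)
      · exact div_pos hY (by linarith)
    · rcases mul_neg_iff.mp h with ⟨hX, hY⟩ | ⟨hX, hY⟩
      · exact div_pos hX (by linarith)
      · exact div_pos_of_neg_of_neg hX (by linarith)
    · rw [← neg_sub Y X, div_neg, ← sub_eq_add_neg, ← sub_div, div_self hne]
  obtain ⟨hu, hv, huv⟩ := weights _ _ h₁
  obtain ⟨hs, ht, hst⟩ := weights _ _ h₂
  refine ⟨_, ⟨_, _, hs, ht, hst, rfl⟩, ⟨_, _, hu, hv, huv, ?_⟩⟩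
  have hne : signedArea a b d - signedArea a b c ≠ 0 := by
    intro h0
    rw [sub_eq_zero.mp h0] at h₁
    nlinarith [mul_self_nonneg (signedArea a b c)]
  have e₁ : signedArea a b c - signedArea a b d = -(signedArea a b d - signedArea a b c) := by
    ring
  have e₂ : signedArea c d b - signedArea c d a =
      -(signedArea a b d - signedArea a b c) := by
    unfold signedArea; ring
  have e₃ : signedArea c d a - signedArea c d b =
      signedArea a b d - signedArea a b c := by
    unfold signedArea; ring
  rw [e₁, e₂, e₃]
  ext i
  simp only [PiLp.add_apply, PiLp.smul_apply, smul_eq_mul]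
  field_simp
  unfold signedArea
  fin_cases i <;> simp <;> ring

theorem IsCrossing.unique (hx : IsCrossing x a b c d) (hy : IsCrossing y a b c d)
    (hc : signedArea a b c ≠ 0) : x = y := by
  have hneg := hx.signedArea_mul_neg hc
  obtain ⟨s, t, hs, ht, hst, hx₁⟩ := exists_coords_of_mem_openSegment hx.1
  obtain ⟨u, v, hu, hv, huv, hx₂⟩ := exists_coords_of_mem_openSegment hx.2
  obtain ⟨s', t', hs', ht', hst', hy₁⟩ := exists_coords_of_mem_openSegment hy.1
  obtain ⟨u', v', hu', hv', huv', hy₂⟩ := exists_coords_of_mem_openSegment hy.2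
  obtain rfl : s = 1 - t := by linarith
  obtain rfl : u = 1 - v := by linarith
  obtain rfl : s' = 1 - t' := by linarith
  obtain rfl : u' = 1 - v' := by linarith
  have h0 := (hx₁ 0).symm.trans (hx₂ 0)
  have h1 := (hx₁ 1).symm.trans (hx₂ 1)
  have h0' := (hy₁ 0).symm.trans (hy₂ 0)
  have h1' := (hy₁ 1).symm.trans (hy₂ 1)
  have hne : signedArea a b d - signedArea a b c ≠ 0 := by
    intro h0
    rw [sub_eq_zero.mp h0] at hneg
    nlinarith [mul_self_nonneg (signedArea a b c)]
  have htt : t = t' := by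
    refine sub_eq_zero.mp ((mul_eq_zero.mp ?_).resolve_right hne)
    unfold signedArea
    linear_combination (d 1 - c 1) * (h0 - h0') - (d 0 - c 0) * (h1 - h1')
  subst htt
  ext i
  rw [hx₁, hy₁]

end Crossing

/-- The point `x` is a crossing of two opposite edges of the complete geometric graph on
`a, b, c, d`. -/
def IsQuadCrossing (x a b c d : EuclideanSpace ℝ (Fin 2)) : Prop :=
  IsCrossing x a b c d ∨ IsCrossing x a c b d ∨ IsCrossing x a d b c

/-- The product of the orientations of the four triangles spanned by `a, b, c, d`: for points in
general position it is positive exactly when they are in convex position. -/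
def orientationProd (a b c d : EuclideanSpace ℝ (Fin 2)) : ℝ :=
  signedArea a b c * signedArea a b d * signedArea a c d * signedArea b c d

section Quad

variable {a b c d x y : EuclideanSpace ℝ (Fin 2)}

/-- The sign conditions imposed by each of the three possible crossings. -/
theorem isCrossing_iff (habc : signedArea a b c ≠ 0) (hacd : signedArea a c d ≠ 0) :
    (∃ x, IsCrossing x a b c d) ↔
      signedArea a b c * signedArea a b d < 0 ∧ signedArea a c d * signedArea b c d < 0 := by
  have h₁ : signedArea c d a = signedArea a c d := signedArea_rotate ..
  have h₂ : signedArea c d b = signedArea b c d := signedArea_rotate ..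
  constructor
  · rintro ⟨x, h⟩
    refine ⟨h.signedArea_mul_neg habc, ?_⟩
    rw [← h₁, ← h₂]
    exact h.symm.signedArea_mul_neg (h₁ ▸ hacd)
  · rintro ⟨h, h'⟩
    exact exists_isCrossing h (by rwa [h₁, h₂])

theorem signedArea_swap_right (a b c : EuclideanSpace ℝ (Fin 2)) :
    signedArea a c b = -signedArea a b c := by
  rw [← signedArea_rotate, signedArea_swap, signedArea_rotate]

theorem isCrossing_middle_iff (habc : signedArea a b c ≠ 0) (habd : signedArea a b d ≠ 0) :
    (∃ x, IsCrossing x a c b d) ↔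
      0 < signedArea a b c * signedArea a c d ∧ 0 < signedArea a b d * signedArea b c d := by
  rw [isCrossing_iff (by rwa [signedArea_swap_right, neg_ne_zero]) habd,
    signedArea_swap_right a b c, signedArea_swap b c d]
  simp

theorem isCrossing_outer_iff (habd : signedArea a b d ≠ 0) (habc : signedArea a b c ≠ 0) :
    (∃ x, IsCrossing x a d b c) ↔
      signedArea a b d * signedArea a c d < 0 ∧ signedArea a b c * signedArea b c d < 0 := by
  rw [isCrossing_iff (by rwa [signedArea_swap_right, neg_ne_zero]) habc,
    signedArea_swap_right a b d, signedArea_swap_right a c d, ← signedArea_rotate d b c]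
  simp

theorem exists_isQuadCrossing_iff (habc : signedArea a b c ≠ 0) (habd : signedArea a b d ≠ 0)
    (hacd : signedArea a c d ≠ 0) (hbcd : signedArea b c d ≠ 0) :
    (∃ x, IsQuadCrossing x a b c d) ↔ 0 < orientationProd a b c d := by
  simp only [IsQuadCrossing, exists_or, isCrossing_iff habc hacd,
    isCrossing_middle_iff habc habd, isCrossing_outer_iff habd habc, orientationProd]
  generalize signedArea a b c = X at *
  generalize signedArea a b d = Y at *
  generalize signedArea a c d = Z at *
  generalize signedArea b c d = W at *
  rcases habc.lt_or_gt with hX | hX <;> rcases habd.lt_or_gt with hY | hY <;>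
    rcases hacd.lt_or_gt with hZ | hZ <;> rcases hbcd.lt_or_gt with hW | hW <;>
    simp only [mul_neg_iff, mul_pos_iff, hX, hY, hZ, hW, hX.not_gt, hY.not_gt, hZ.not_gt,
      hW.not_gt, and_true, and_false, or_true, or_false, and_self, or_self]

theorem IsQuadCrossing.unique (hx : IsQuadCrossing x a b c d) (hy : IsQuadCrossing y a b c d)
    (habc : signedArea a b c ≠ 0) (habd : signedArea a b d ≠ 0)
    (hacd : signedArea a c d ≠ 0) : x = y := by
  have hadd := signedArea_add_signedArea a b c d
  have h₁ : ∀ z, IsCrossing z a b c d → _ := fun z h => (isCrossing_iff habc hacd).1 ⟨z, h⟩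
  have h₂ : ∀ z, IsCrossing z a c b d → _ :=
    fun z h => (isCrossing_middle_iff habc habd).1 ⟨z, h⟩
  have h₃ : ∀ z, IsCrossing z a d b c → _ :=
    fun z h => (isCrossing_outer_iff habd habc).1 ⟨z, h⟩
  have hacb : signedArea a c b ≠ 0 := by rwa [signedArea_swap_right, neg_ne_zero]
  have hadb : signedArea a d b ≠ 0 := by rwa [signedArea_swap_right, neg_ne_zero]
  simp only [mul_neg_iff, mul_pos_iff] at h₁ h₂ h₃
  rcases hx with hx | hx | hx <;> rcases hy with hy | hy | hy
  · exact hx.unique hy habc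
  · grind
  · grind
  · grind
  · exact hx.unique hy hacb
  · grind
  · grind
  · grind
  · exact hx.unique hy hadb

end Quad

theorem zero_lt_neg_one_pow_card_mul_prod {ι : Type*} (s : Finset ι) (f : ι → ℝ)
    (hf : ∀ i ∈ s, f i ≠ 0) :
    0 < (-1) ^ (s.filter fun i => f i < 0).card * ∏ i ∈ s, f i := by
  classical
  induction s using Finset.induction_on with
  | empty => simp
  | insert a s ha ih =>
    have ih := ih fun i hi => hf i (Finset.mem_insert_of_mem hi)
    rw [Finset.prod_insert ha, Finset.filter_insert]
    rcases (hf a (Finset.mem_insert_self a s)).lt_or_gt with h | h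
    · rw [if_pos h, Finset.card_insert_of_notMem (by simp [ha])]
      have := mul_pos (neg_pos.2 h) ih
      rw [pow_succ]
      linarith
    · rw [if_neg h.not_gt]
      have := mul_pos h ih
      linarith

theorem odd_card_filter_pos {ι : Type*} (s : Finset ι) (f : ι → ℝ) (hs : Odd s.card)
    (hf : 0 < ∏ i ∈ s, f i) : Odd (s.filter fun i => 0 < f i).card := by
  have hne : ∀ i ∈ s, f i ≠ 0 := Finset.prod_ne_zero_iff.1 hf.ne'
  have h := zero_lt_neg_one_pow_card_mul_prod s (fun i => -f i) (by simpa using hne)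
  simp only [neg_lt_zero, Finset.prod_neg, hs.neg_one_pow] at h
  by_contra hodd
  rw [Nat.not_odd_iff_even] at hodd
  rw [hodd.neg_one_pow] at h
  linarith

theorem List.Nodup.mem_of_length_eq_card {α : Type*} [Fintype α] {l : List α} (h : l.Nodup)
    (hl : l.length = Fintype.card α) (a : α) : a ∈ l := by
  classical
  have huniv : l.toFinset = Finset.univ := by
    rw [← Finset.card_eq_iff_eq_univ, List.toFinset_card_of_nodup h, hl]
  exact List.mem_toFinset.1 (huniv ▸ Finset.mem_univ a)

section FivePoints

variable {p : Fin 5 → EuclideanSpace ℝ (Fin 2)} {x : EuclideanSpace ℝ (Fin 2)}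

/-- The point `x` is a crossing of two segments joining the points `p i` with `i ≠ m`. -/
def IsCrossingOmitting (p : Fin 5 → EuclideanSpace ℝ (Fin 2)) (m : Fin 5)
    (x : EuclideanSpace ℝ (Fin 2)) : Prop :=
  IsQuadCrossing x (p (m + 1)) (p (m + 2)) (p (m + 3)) (p (m + 4))

theorem isCrossingOmitting_iff {m : Fin 5} :
    IsCrossingOmitting p m x ↔ ∃ i j k l : Fin 5, [m, i, j, k, l].Nodup ∧
      x ∈ openSegment ℝ (p i) (p j) ∧ x ∈ openSegment ℝ (p k) (p l) := by
  constructor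
  · have hnodup : ∀ m : Fin 5, [m, m + 1, m + 2, m + 3, m + 4].Nodup ∧
        [m, m + 1, m + 3, m + 2, m + 4].Nodup ∧ [m, m + 1, m + 4, m + 2, m + 3].Nodup := by
      decide
    obtain ⟨h₁, h₂, h₃⟩ := hnodup m
    rintro (⟨h, h'⟩ | ⟨h, h'⟩ | ⟨h, h'⟩)
    · exact ⟨_, _, _, _, h₁, h, h'⟩
    · exact ⟨_, _, _, _, h₂, h, h'⟩
    · exact ⟨_, _, _, _, h₃, h, h'⟩
  · rintro ⟨i, j, k, l, hnodup, h, h'⟩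
    have hij := openSegment_symm ℝ (p i) (p j)
    have hkl := openSegment_symm ℝ (p k) (p l)
    have hmem : ∀ n : Fin 5, m ≠ n → n = m + 1 ∨ n = m + 2 ∨ n = m + 3 ∨ n = m + 4 := by
      clear * -
      decide +revert
    simp only [List.nodup_cons, List.mem_cons, List.not_mem_nil, or_false, not_or] at hnodup
    obtain ⟨⟨hi, hj, hk, hl⟩, hne⟩ := hnodup
    unfold IsCrossingOmitting IsQuadCrossing IsCrossing
    rcases hmem i hi with rfl | rfl | rfl | rfl <;>
      rcases hmem j hj with rfl | rfl | rfl | rfl <;>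
      first
      | exact absurd rfl hne.1.1
      | (rcases hmem k hk with rfl | rfl | rfl | rfl <;>
          first
          | exact absurd rfl hne.1.2.1
          | exact absurd rfl hne.2.1.1
          | (rcases hmem l hl with rfl | rfl | rfl | rfl <;>
              first
              | exact absurd rfl hne.1.2.2
              | exact absurd rfl hne.2.1.2
              | exact absurd rfl hne.2.2.1
              | (clear hi hj hk hl hne hmem
                 simp_all only [true_or, or_true, and_self])))

theorem eq_of_mem_openSegment
    (hp : ∀ i j k : Fin 5, i ≠ j → i ≠ k → j ≠ k → signedArea (p i) (p j) (p k) ≠ 0)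
    {i j k : Fin 5} (hij : i ≠ j) (hik : i ≠ k) (hj : x ∈ openSegment ℝ (p i) (p j))
    (hk : x ∈ openSegment ℝ (p i) (p k)) : j = k := by
  by_contra hjk
  exact hp i j k hij hik hjk (signedArea_eq_zero_of_mem_openSegment hj hk)

theorem IsCrossingOmitting.eq
    (hp : ∀ i j k : Fin 5, i ≠ j → i ≠ k → j ≠ k → signedArea (p i) (p j) (p k) ≠ 0)
    {m n : Fin 5} (hm : IsCrossingOmitting p m x) (hn : IsCrossingOmitting p n x) : m = n := by
  rw [isCrossingOmitting_iff] at hm hn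
  -- Each vertex other than `n` lies on a segment through `x`, and so does its neighbour.
  have neighbour : ∀ q : Fin 5, q ≠ n → ∃ r, q ≠ r ∧ r ≠ n ∧ x ∈ openSegment ℝ (p q) (p r) := by
    obtain ⟨i, j, k, l, hnodup, h, h'⟩ := hn
    have hmem : ∀ q : Fin 5, q ≠ n → q = i ∨ q = j ∨ q = k ∨ q = l := by
      intro q hq
      simpa [hq] using hnodup.mem_of_length_eq_card rfl q
    simp only [List.nodup_cons, List.mem_cons, List.not_mem_nil, or_false, not_or] at hnodup
    obtain ⟨⟨hi, hj, hk, hl⟩, ⟨hij, -⟩, -, hkl, -⟩ := hnodup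
    intro q hq
    rcases hmem q hq with rfl | rfl | rfl | rfl
    · exact ⟨j, hij, Ne.symm hj, h⟩
    · exact ⟨i, Ne.symm hij, Ne.symm hi, openSegment_symm ℝ (p i) (p q) ▸ h⟩
    · exact ⟨l, hkl, Ne.symm hl, h'⟩
    · exact ⟨k, Ne.symm hkl, Ne.symm hk, openSegment_symm ℝ (p k) (p q) ▸ h'⟩
  have not_mem : ∀ q : Fin 5, q ≠ n → x ∉ openSegment ℝ (p q) (p n) := by
    intro q hq h
    obtain ⟨r, hqr, hrn, hr⟩ := neighbour q hq
    exact hrn (eq_of_mem_openSegment hp hqr hq hr h)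
  obtain ⟨i, j, k, l, hnodup, h, h'⟩ := hm
  have hmem : n = m ∨ n = i ∨ n = j ∨ n = k ∨ n = l := by
    simpa using hnodup.mem_of_length_eq_card rfl n
  simp only [List.nodup_cons, List.mem_cons, List.not_mem_nil, or_false, not_or] at hnodup
  obtain ⟨-, ⟨hij, -⟩, -, hkl, -⟩ := hnodup
  rcases hmem with rfl | rfl | rfl | rfl | rfl
  · rfl
  · exact absurd (openSegment_symm ℝ (p n) (p j) ▸ h) (not_mem j (Ne.symm hij))
  · exact absurd h (not_mem i hij)
  · exact absurd (openSegment_symm ℝ (p n) (p l) ▸ h') (not_mem l (Ne.symm hkl))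
  · exact absurd h' (not_mem k hkl)

theorem exists_isCrossingOmitting_iff
    (hp : ∀ i j k : Fin 5, i ≠ j → i ≠ k → j ≠ k → signedArea (p i) (p j) (p k) ≠ 0)
    (x : EuclideanSpace ℝ (Fin 2)) :
    (∃ m, IsCrossingOmitting p m x) ↔ ∃ i j k l : Fin 5, i ≠ j ∧ k ≠ l ∧
      ({i, j} : Finset (Fin 5)) ≠ ({k, l} : Finset (Fin 5)) ∧
      x ∈ openSegment ℝ (p i) (p j) ∧ x ∈ openSegment ℝ (p k) (p l) := by
  simp only [isCrossingOmitting_iff]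
  constructor
  · rintro ⟨m, i, j, k, l, hnodup, h⟩
    simp only [List.nodup_cons, List.mem_cons, List.not_mem_nil, or_false, not_or] at hnodup
    obtain ⟨-, ⟨hij, hik, hil⟩, -, hkl, -⟩ := hnodup
    refine ⟨i, j, k, l, hij, hkl, fun heq => ?_, h⟩
    have hi : i ∈ ({k, l} : Finset (Fin 5)) := heq ▸ Finset.mem_insert_self i {j}
    simp [hik, hil] at hi
  · rintro ⟨i, j, k, l, hij, hkl, hne, h, h'⟩
    have hs := openSegment_symm ℝ (p i) (p j) ▸ h
    have hs' := openSegment_symm ℝ (p k) (p l) ▸ h'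
    have hik : i ≠ k := by
      rintro rfl
      exact hne (by rw [eq_of_mem_openSegment hp hij hkl h h'])
    have hil : i ≠ l := by
      rintro rfl
      exact hne (by rw [eq_of_mem_openSegment hp hij hkl.symm h hs', Finset.pair_comm])
    have hjk : j ≠ k := by
      rintro rfl
      exact hne (by rw [eq_of_mem_openSegment hp hij.symm hkl hs h', Finset.pair_comm])
    have hjl : j ≠ l := by
      rintro rfl
      exact hne (by rw [eq_of_mem_openSegment hp hij.symm hkl.symm hs hs'])
    obtain ⟨m, hm⟩ : ∃ m, m ∉ ({i, j, k, l} : Finset (Fin 5)) := by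
      by_contra! hall
      have hcard := Finset.card_le_card (fun m _ => hall m : Finset.univ ⊆ _)
      exact absurd (hcard.trans Finset.card_le_four) (by simp)
    simp only [Finset.mem_insert, Finset.mem_singleton, not_or] at hm
    exact ⟨m, i, j, k, l, by simp [*], h, h'⟩

theorem prod_orientationProd_pos
    (hp : ∀ i j k : Fin 5, i ≠ j → i ≠ k → j ≠ k → signedArea (p i) (p j) (p k) ≠ 0) :
    0 < ∏ m : Fin 5, orientationProd (p (m + 1)) (p (m + 2)) (p (m + 3)) (p (m + 4)) := by
  set A : Fin 5 → ℝ := fun m => signedArea (p m) (p (m + 1)) (p (m + 2)) with hA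
  set B : Fin 5 → ℝ := fun m => signedArea (p m) (p (m + 1)) (p (m + 3)) with hB
  have hfactor : ∀ m, orientationProd (p (m + 1)) (p (m + 2)) (p (m + 3)) (p (m + 4)) =
      A (m + 1) * B (m + 1) * B (m + 3) * A (m + 2) := by
    intro m
    simp only [hA, hB, orientationProd, add_assoc, Fin.reduceAdd]
    rw [← signedArea_rotate (p (m + 1)) (p (m + 3)) (p (m + 4))]
  have hshift : ∀ (f : Fin 5 → ℝ) (c : Fin 5), ∏ m, f (m + c) = ∏ m, f m := fun f c =>
    Equiv.prod_comp (Equiv.addRight c) f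
  have hne : ∀ m : Fin 5, m ≠ m + 1 ∧ m ≠ m + 2 ∧ m + 1 ≠ m + 2 ∧ m ≠ m + 3 ∧ m + 1 ≠ m + 3 := by
    decide
  have hA0 : ∏ m, A m ≠ 0 := Finset.prod_ne_zero_iff.2 fun m _ =>
    hp _ _ _ (hne m).1 (hne m).2.1 (hne m).2.2.1
  have hB0 : ∏ m, B m ≠ 0 := Finset.prod_ne_zero_iff.2 fun m _ =>
    hp _ _ _ (hne m).1 (hne m).2.2.2.1 (hne m).2.2.2.2
  have hpos : 0 < ((∏ m, A m) * ∏ m, B m) ^ 2 := by positivity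
  simp only [hfactor, Finset.prod_mul_distrib, hshift]
  linarith

end FivePoints


/-- If no 3 of 5 pairwise distinct points in the plane are collinear, then the set of
intersection points of interiors of segments joining the 5 points is finite of odd
cardinality. -/
theorem stmt_1 (p : Fin 5 → EuclideanSpace ℝ (Fin 2)) (hp : Function.Injective p)
    (hcol : ∀ i j k : Fin 5, i ≠ j → i ≠ k → j ≠ k →
      ¬ Collinear ℝ ({p i, p j, p k} : Set (EuclideanSpace ℝ (Fin 2)))) :
    ({x : EuclideanSpace ℝ (Fin 2) | ∃ i j k l : Fin 5, i ≠ j ∧ k ≠ l ∧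
        ({i, j} : Finset (Fin 5)) ≠ ({k, l} : Finset (Fin 5)) ∧
        x ∈ openSegment ℝ (p i) (p j) ∧ x ∈ openSegment ℝ (p k) (p l)}).Finite ∧
    Odd ({x : EuclideanSpace ℝ (Fin 2) | ∃ i j k l : Fin 5, i ≠ j ∧ k ≠ l ∧
        ({i, j} : Finset (Fin 5)) ≠ ({k, l} : Finset (Fin 5)) ∧
        x ∈ openSegment ℝ (p i) (p j) ∧ x ∈ openSegment ℝ (p k) (p l)}).ncard := by
  have harea : ∀ i j k : Fin 5, i ≠ j → i ≠ k → j ≠ k →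
      signedArea (p i) (p j) (p k) ≠ 0 := fun i j k hij hik hjk h =>
    hcol i j k hij hik hjk (collinear_of_signedArea_eq_zero (hp.ne hij) h)
  simp only [← exists_isCrossingOmitting_iff harea]
  have hne : ∀ m : Fin 5, m + 1 ≠ m + 2 ∧ m + 1 ≠ m + 3 ∧ m + 1 ≠ m + 4 ∧ m + 2 ≠ m + 3 ∧
      m + 2 ≠ m + 4 ∧ m + 3 ≠ m + 4 := by
    decide
  choose! f hf using fun x (hx : ∃ m, IsCrossingOmitting p m x) => hx
  have hinj : Set.InjOn f {x | ∃ m, IsCrossingOmitting p m x} := by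
    intro x hx y hy hxy
    obtain ⟨h12, h13, h14, h23, h24, h34⟩ := hne (f x)
    exact (hf x hx).unique (hxy ▸ hf y hy) (harea _ _ _ h12 h13 h23) (harea _ _ _ h12 h14 h24)
      (harea _ _ _ h13 h14 h34)
  refine ⟨Set.Finite.of_finite_image (Set.toFinite _) hinj, ?_⟩
  have himage : f '' {x | ∃ m, IsCrossingOmitting p m x} = (Finset.univ.filter fun m : Fin 5 =>
      0 < orientationProd (p (m + 1)) (p (m + 2)) (p (m + 3)) (p (m + 4)) : Finset (Fin 5)) := by
    ext m
    obtain ⟨h12, h13, h14, h23, h24, h34⟩ := hne m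
    simp only [Finset.coe_filter, Finset.mem_univ, true_and, Set.mem_ofPred_eq, Set.mem_image]
    rw [← exists_isQuadCrossing_iff (harea _ _ _ h12 h13 h23) (harea _ _ _ h12 h14 h24)
      (harea _ _ _ h13 h14 h34) (harea _ _ _ h23 h24 h34)]
    constructor
    · rintro ⟨x, hx, rfl⟩
      exact ⟨x, hf x hx⟩
    · rintro ⟨x, hx⟩
      exact ⟨x, ⟨m, hx⟩, (hf x ⟨m, hx⟩).eq harea hx⟩
  rw [← hinj.ncard_image, himage, Set.ncard_coe_finset]
  exact odd_card_filter_pos _ _ (by decide) (prod_orientationProd_pos harea)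
end

section
/- Let a₁, a₂, a₃ and b₁, b₂, b₃ be two triples of points in the plane ℝ², all six points pairwise distinct. Then there exist indices i, k ∈ {1,2,3} with i ≠ k and indices j, l ∈ {1,2,3} with j ≠ l such that the closed segment joining a_i and b_j intersects the closed segment joining a_k and b_l (segment ℝ (a i) (b j) ∩ segment ℝ (a k) (b l) is nonempty). In particular the two segments have no common vertices. -/
/-- The median of the three coordinates of a vector. -/
def coordMedian (u : Fin 3 → ℝ) : ℝ :=
  max (min (u 0) (u 1)) (min (max (u 0) (u 1)) (u 2))

lemma continuous_coordMedian : Continuous coordMedian := by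
  unfold coordMedian
  fun_prop

lemma coordMedian_neg (u : Fin 3 → ℝ) : coordMedian (-u) = -coordMedian u := by
  simp only [coordMedian, Pi.neg_apply]
  grind

lemma coordMedian_smul (r : ℝ) (u : Fin 3 → ℝ) : coordMedian (r • u) = r * coordMedian u := by
  have key : ∀ r : ℝ, 0 ≤ r → coordMedian (r • u) = r * coordMedian u := by
    intro r hr
    simp [coordMedian, mul_max_of_nonneg, mul_min_of_nonneg, hr]
  rcases le_total 0 r with hr | hr
  · exact key r hr
  · rw [← neg_neg r, neg_smul, coordMedian_neg, key (-r) (by linarith)]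
    ring

/-- The coordinate median vanishes only at vectors with at most one positive and at most one
negative coordinate. -/
lemma exists_eq_single_sub_single {u : Fin 3 → ℝ} (hu : coordMedian u = 0) :
    ∃ (i k : Fin 3) (s t : ℝ), i ≠ k ∧ 0 ≤ s ∧ 0 ≤ t ∧ u = Pi.single i s - Pi.single k t := by
  have key : ∀ i k l : Fin 3, i ≠ k → i ≠ l → k ≠ l → 0 ≤ u i → u k ≤ 0 → u l = 0 →
      ∃ (i k : Fin 3) (s t : ℝ), i ≠ k ∧ 0 ≤ s ∧ 0 ≤ t ∧ u = Pi.single i s - Pi.single k t := by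
    intro i k l hik hil hkl hi hk hl
    refine ⟨i, k, u i, -u k, hik, hi, by linarith, ?_⟩
    ext x
    have hx : x = i ∨ x = k ∨ x = l := by omega
    rcases hx with rfl | rfl | rfl <;> simp [*, Ne.symm]
  have h : (u 0 = 0 ∧ u 1 * u 2 ≤ 0) ∨ (u 1 = 0 ∧ u 0 * u 2 ≤ 0) ∨
      (u 2 = 0 ∧ u 0 * u 1 ≤ 0) := by
    simp only [coordMedian] at hu
    simp only [mul_nonpos_iff]
    grind
  simp only [mul_nonpos_iff] at h
  rcases h with ⟨h, hm | hm⟩ | ⟨h, hm | hm⟩ | ⟨h, hm | hm⟩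
  · exact key 1 2 0 (by decide) (by decide) (by decide) hm.1 hm.2 h
  · exact key 2 1 0 (by decide) (by decide) (by decide) hm.2 hm.1 h
  · exact key 0 2 1 (by decide) (by decide) (by decide) hm.1 hm.2 h
  · exact key 2 0 1 (by decide) (by decide) (by decide) hm.2 hm.1 h
  · exact key 0 1 2 (by decide) (by decide) (by decide) hm.1 hm.2 h
  · exact key 1 0 2 (by decide) (by decide) (by decide) hm.2 hm.1 h

/-- An odd continuous function taking values of the same sign at `x` and `y` vanishes on the
segment from `x` to `-y`. -/
lemma exists_odd_eq_zero {E : Type*} [AddCommGroup E] [Module ℝ E] [TopologicalSpace E]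
    [IsTopologicalAddGroup E] [ContinuousSMul ℝ E] {g : E → ℝ} (hg : Continuous g)
    (hodd : ∀ x, g (-x) = -g x) {x y : E} (h : 0 ≤ g x * g y) :
    ∃ t ∈ Set.Icc (0 : ℝ) 1, g ((1 - t) • x - t • y) = 0 := by
  have hc : ContinuousOn (fun t : ℝ => g ((1 - t) • x - t • y)) (Set.uIcc 0 1) := by fun_prop
  have hmem : (0 : ℝ) ∈ Set.uIcc (g ((1 - (0 : ℝ)) • x - (0 : ℝ) • y))
      (g ((1 - (1 : ℝ)) • x - (1 : ℝ) • y)) := by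
    rw [Set.mem_uIcc]
    simp only [sub_zero, one_smul, zero_smul, sub_self, zero_sub, hodd]
    rcases mul_nonneg_iff.1 h with h | h
    · right; constructor <;> linarith
    · left; constructor <;> linarith
  obtain ⟨t, ht, h0⟩ := intermediate_value_uIcc hc hmem
  exact ⟨t, by simpa using ht, h0⟩

/-- An odd continuous function on `ℝ³` vanishes at a nonzero vector whose coordinates have
median zero. -/
lemma exists_coordMedian_eq_zero_of_odd {g : (Fin 3 → ℝ) → ℝ} (hg : Continuous g)
    (hodd : ∀ x, g (-x) = -g x) : ∃ v ≠ 0, coordMedian v = 0 ∧ g v = 0 := by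
  have key : ∀ i j : Fin 3, i ≠ j → 0 ≤ g (Pi.single i 1) * g (Pi.single j 1) →
      ∃ v ≠ 0, coordMedian v = 0 ∧ g v = 0 := by
    intro i j hij h
    obtain ⟨t, ⟨ht0, ht1⟩, h0⟩ := exists_odd_eq_zero hg hodd h
    refine ⟨_, fun h => ?_, ?_, h0⟩
    · have hi := congrFun h i
      have hj := congrFun h j
      simp [hij, hij.symm] at hi hj
      linarith
    · fin_cases i <;> fin_cases j <;> simp [coordMedian] at hij ⊢ <;> grind
  by_cases h01 : 0 ≤ g (Pi.single 0 1) * g (Pi.single 1 1)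
  · exact key 0 1 (by decide) h01
  by_cases h02 : 0 ≤ g (Pi.single 0 1) * g (Pi.single 2 1)
  · exact key 0 2 (by decide) h02
  · refine key 1 2 (by decide) ?_
    push Not at h01 h02
    by_contra! h
    nlinarith [mul_pos_of_neg_of_neg h01 h02, mul_self_nonneg (g (Pi.single 0 1))]

/-- A linear map from a real vector space of dimension at least two to `ℝ³` sends some nonzero
vector to a vector whose coordinates have median zero. -/
lemma exists_ne_zero_coordMedian_eq_zero {K : Type*} [AddCommGroup K] [Module ℝ K]
    (hK : 1 < Module.finrank ℝ K) (f : K →ₗ[ℝ] (Fin 3 → ℝ)) :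
    ∃ z ≠ 0, coordMedian (f z) = 0 := by
  have : Nontrivial K := Module.nontrivial_of_finrank_pos (R := ℝ) (by omega)
  obtain ⟨p, hp⟩ := exists_ne (0 : K)
  obtain ⟨q, hpq⟩ := exists_linearIndependent_pair_of_one_lt_finrank hK hp
  have key : ∀ q : K, LinearIndependent ℝ ![p, q] →
      0 ≤ coordMedian (f p) * coordMedian (f q) → ∃ z ≠ 0, coordMedian (f z) = 0 := by
    intro q hpq h
    obtain ⟨t, -, h0⟩ := exists_odd_eq_zero continuous_coordMedian coordMedian_neg h
    refine ⟨(1 - t) • p - t • q, fun hz => ?_, by simpa using h0⟩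
    have := LinearIndependent.pair_iff.1 hpq (1 - t) (-t) (by rw [← hz]; module)
    linarith [this.1, this.2]
  by_cases h : 0 ≤ coordMedian (f p) * coordMedian (f q)
  · exact key q hpq h
  · refine key (-q) ?_ ?_
    · rw [LinearIndependent.pair_iff] at hpq ⊢
      intro s t hst
      simpa using hpq s (-t) (by rw [← hst]; module)
    · rw [map_neg, coordMedian_neg]
      linarith

lemma exists_coordMedian_add_smul_eq_zero (w : Fin 3 → ℝ) {n : Fin 3 → ℝ}
    (hn : coordMedian n ≠ 0) : ∃ r : ℝ, coordMedian (w + r • n) = 0 := by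
  obtain ⟨⟨s, t⟩, hne, h⟩ := exists_ne_zero_coordMedian_eq_zero (K := ℝ × ℝ) (by simp)
    ((LinearMap.toSpanSingleton ℝ _ w).coprod (LinearMap.toSpanSingleton ℝ _ n))
  replace h : coordMedian (s • w + t • n) = 0 := h
  have hs : s ≠ 0 := by
    rintro rfl
    simp_all [coordMedian_smul]
  refine ⟨t / s, ?_⟩
  rw [show w + (t / s) • n = s⁻¹ • (s • w + t • n) by match_scalars <;> field_simp,
    coordMedian_smul, h, mul_zero]

/-- Two linear maps from `ℝ³` to a three-dimensional space agree at some pair of vectors, not both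
zero, whose coordinates have median zero. -/
lemma exists_map_eq_map_coordMedian_eq_zero {V : Type*} [AddCommGroup V] [Module ℝ V]
    [FiniteDimensional ℝ V] (hV : Module.finrank ℝ V = 3) (A B : (Fin 3 → ℝ) →ₗ[ℝ] V) :
    ∃ u v, (u, v) ≠ 0 ∧ coordMedian u = 0 ∧ coordMedian v = 0 ∧ A u = B v := by
  by_cases hA : Function.Injective A
  · let e := LinearEquiv.ofInjectiveOfFinrankEq A hA (by simp [hV])
    have he : ∀ x, A (e.symm x) = x := e.apply_symm_apply
    let C : (Fin 3 → ℝ) →ₗ[ℝ] (Fin 3 → ℝ) := e.symm.toLinearMap ∘ₗ B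
    obtain ⟨v, hv, hv0, hCv⟩ := exists_coordMedian_eq_zero_of_odd
      (continuous_coordMedian.comp C.continuous_of_finiteDimensional)
      (fun x => by simp [coordMedian_neg])
    exact ⟨C v, v, by simp [hv], hCv, hv0, he _⟩
  · rw [injective_iff_map_eq_zero] at hA
    push Not at hA
    obtain ⟨n, hAn, hn⟩ := hA
    by_cases hn0 : coordMedian n = 0
    · exact ⟨n, 0, by simp [hn], hn0, by simp [coordMedian], by simp [hAn]⟩
    obtain ⟨i, hi⟩ := Function.ne_iff.1 hn
    let L : (Fin 3 → ℝ) × (Fin 3 → ℝ) →ₗ[ℝ] V × ℝ :=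
      (A.coprod (-B)).prod (LinearMap.proj i ∘ₗ LinearMap.fst ℝ _ _)
    have hK : 1 < Module.finrank ℝ (LinearMap.ker L) := by
      have h := L.finrank_range_add_finrank_ker
      have h' := (LinearMap.range L).finrank_le
      simp [hV] at h h'
      omega
    obtain ⟨⟨⟨x, y⟩, hz⟩, hne, hy⟩ := exists_ne_zero_coordMedian_eq_zero hK
      (LinearMap.snd ℝ _ _ ∘ₗ (LinearMap.ker L).subtype)
    obtain ⟨hxy, hxi⟩ : A x + -B y = 0 ∧ x i = 0 := by simpa [L] using hz
    obtain ⟨r, hr⟩ := exists_coordMedian_add_smul_eq_zero x hn0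
    refine ⟨x + r • n, y, fun h => hne ?_, hr, hy, ?_⟩
    · simp only [Prod.mk_eq_zero] at h
      have hr0 : r = 0 := by
        have := congrFun h.1 i
        simpa [hxi, show n i ≠ 0 from hi] using this
      simpa [hr0] using h
    · rw [map_add, map_smul, hAn, smul_zero, add_zero]
      exact add_neg_eq_zero.1 hxy

/-- Linear non-planarity of `K₃,₃`: given two triples of points in the plane (all six
points pairwise distinct), there exist two intersecting segments without common
vertices, each joining points from distinct triples. -/
theorem stmt_2 (a b : Fin 3 → EuclideanSpace ℝ (Fin 2))
    (hdist : Function.Injective (Sum.elim a b : Fin 3 ⊕ Fin 3 → EuclideanSpace ℝ (Fin 2))) :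
    ∃ i k j l : Fin 3, i ≠ k ∧ j ≠ l ∧
      (segment ℝ (a i) (b j) ∩ segment ℝ (a k) (b l)).Nonempty := by
  let H (c : Fin 3 → EuclideanSpace ℝ (Fin 2)) :=
    Fintype.linearCombination ℝ (fun i => (c i, (1 : ℝ)))
  obtain ⟨u, v, hne, hu, hv, huv⟩ :=
    exists_map_eq_map_coordMedian_eq_zero (by simp) (H a) (H b)
  obtain ⟨i, k, s, t, hik, hs, ht, rfl⟩ := exists_eq_single_sub_single hu
  obtain ⟨l, j, p, q, hlj, hp, hq, rfl⟩ := exists_eq_single_sub_single hv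
  simp only [H, map_sub, Fintype.linearCombination_apply_single, Prod.smul_mk, Prod.mk_sub_mk,
    Prod.mk.injEq, smul_eq_mul, mul_one] at huv
  obtain ⟨hpt, hsum⟩ := huv
  have hc : 0 < s + q := by
    refine lt_of_le_of_ne (by positivity) fun h => hne ?_
    obtain rfl : s = 0 := by linarith
    obtain rfl : q = 0 := by linarith
    obtain rfl : t = 0 := by linarith
    obtain rfl : p = 0 := by linarith
    simp
  have hsum' : t + p = s + q := by linarith
  refine ⟨i, k, j, l, hik, hlj.symm, (s + q)⁻¹ • (s • a i + q • b j),
    ⟨s / (s + q), q / (s + q), by positivity, by positivity, by field_simp, ?_⟩,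
    ⟨t / (s + q), p / (s + q), by positivity, by positivity, ?_, ?_⟩⟩
  · module
  · rw [← add_div, hsum', div_self hc.ne']
  · rw [sub_eq_sub_iff_add_eq_add] at hpt
    rw [hpt]
    module
end

section
/- For every natural number n there exist n points p₁,…,p_n in 3-space ℝ³ (i.e., an injective map p : Fin n → EuclideanSpace ℝ (Fin 3)) such that for any two distinct unordered pairs of indices {i,j} ≠ {k,l}, the closed segment joining p_i and p_j is disjoint from the interior (open segment) of the segment joining p_k and p_l: segment ℝ (p i) (p j) ∩ openSegment ℝ (p k) (p l) = ∅. -/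
/-- The moment curve `x ↦ (x, x², x³)` in 3-space. -/
noncomputable def momentCurve (x : ℝ) : EuclideanSpace ℝ (Fin 3) :=
  !₂[x, x ^ 2, x ^ 3]

theorem momentCurve_injective : Function.Injective momentCurve := fun x y h => by
  simpa [momentCurve] using congrArg (fun v => v 0) h

/-- The inner part of a chord of the moment curve misses every line through two points of the curve
that are different from one of the endpoints of the chord. -/
theorem momentCurve_combination_ne {a b c d s s' t t' : ℝ} (hca : c ≠ a) (hcb : c ≠ b)
    (hcd : c ≠ d) (hs : s + s' = 1) (ht : t + t' = 1) (ht0 : t ≠ 0) :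
    s • momentCurve a + s' • momentCurve b ≠ t • momentCurve c + t' • momentCurve d := by
  intro h
  have h1 : s * a + s' * b = t * c + t' * d := by
    simpa [momentCurve] using congrArg (fun v => v 0) h
  have h2 : s * a ^ 2 + s' * b ^ 2 = t * c ^ 2 + t' * d ^ 2 := by
    simpa [momentCurve] using congrArg (fun v => v 1) h
  have h3 : s * a ^ 3 + s' * b ^ 3 = t * c ^ 3 + t' * d ^ 3 := by
    simpa [momentCurve] using congrArg (fun v => v 2) h
  -- Evaluate the cubic `(x - a) (x - b) (x - d)` on both sides.
  have key : t * ((c - a) * (c - b) * (c - d)) = 0 := by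
    linear_combination -h3 + (a + b + d) * h2 - (a * b + a * d + b * d) * h1 +
      a * b * d * (hs - ht)
  simp [ht0, sub_eq_zero, hca, hcb, hcd] at key

theorem segment_inter_openSegment_momentCurve {a b c d : ℝ} (hca : c ≠ a) (hcb : c ≠ b)
    (hcd : c ≠ d) :
    segment ℝ (momentCurve a) (momentCurve b) ∩
      openSegment ℝ (momentCurve c) (momentCurve d) = ∅ := by
  refine Set.eq_empty_of_forall_notMem ?_
  rintro x ⟨⟨s, s', -, -, hs, rfl⟩, ⟨t, t', ht0, -, ht, h⟩⟩
  exact momentCurve_combination_ne hca hcb hcd hs ht ht0.ne' h.symm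

/-- General Position Theorem: for any `n` there exist `n` points in 3-space such that no
segment joining the points intersects the interior of any other such segment. -/
theorem stmt_3 (n : ℕ) :
    ∃ p : Fin n → EuclideanSpace ℝ (Fin 3), Function.Injective p ∧
      ∀ i j k l : Fin n, i ≠ j → k ≠ l →
        ({i, j} : Finset (Fin n)) ≠ ({k, l} : Finset (Fin n)) →
        segment ℝ (p i) (p j) ∩ openSegment ℝ (p k) (p l) = ∅ := by
  have hinj : Function.Injective fun i : Fin n => (i : ℝ) :=
    Nat.cast_injective.comp Fin.val_injective
  refine ⟨fun i => momentCurve i, momentCurve_injective.comp hinj, ?_⟩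
  intro i j k l _ hkl hne
  have hcases : (k ≠ i ∧ k ≠ j) ∨ (l ≠ i ∧ l ≠ j) := by
    by_contra! hcon
    apply hne
    ext x
    simp only [Finset.mem_insert, Finset.mem_singleton]
    grind
  rcases hcases with ⟨hi, hj⟩ | ⟨hi, hj⟩
  · exact segment_inter_openSegment_momentCurve (hinj.ne hi) (hinj.ne hj) (hinj.ne hkl)
  · rw [openSegment_symm]
    exact segment_inter_openSegment_momentCurve (hinj.ne hi) (hinj.ne hj) (hinj.ne hkl.symm)
end

section
/- Let p₁,…,p₅ be 5 points in the plane ℝ² such that no three of them are collinear. Suppose that for every two distinct unordered pairs {i,j} and {k,l} of indices in {1,…,5}, each pair being different from {1,2}, the interiors of the corresponding segments are disjoint: openSegment ℝ (p i) (p j) ∩ openSegment ℝ (p k) (p l) = ∅. Then exactly one of the two points p₁, p₂ lies in the interior of the triangle with vertices p₃, p₄, p₅; that is, (p₁ ∈ interior (convexHull ℝ {p₃, p₄, p₅})) Xor (p₂ ∈ interior (convexHull ℝ {p₃, p₄, p₅})). -/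
/-- Twice the signed area of the triangle `a b c`. -/
def orient (a b c : EuclideanSpace ℝ (Fin 2)) : ℝ :=
  (b 0 - a 0) * (c 1 - a 1) - (b 1 - a 1) * (c 0 - a 0)

theorem orient_rotate (a b c : EuclideanSpace ℝ (Fin 2)) : orient b c a = orient a b c := by
  unfold orient; ring

theorem orient_swap_right (a b c : EuclideanSpace ℝ (Fin 2)) : orient a c b = -orient a b c := by
  unfold orient; ring

theorem collinear_of_orient_eq_zero {a b c : EuclideanSpace ℝ (Fin 2)} (h : orient a b c = 0) :
    Collinear ℝ ({a, b, c} : Set (EuclideanSpace ℝ (Fin 2))) := by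
  unfold orient at h
  rw [collinear_iff_of_mem (p₀ := a) (by simp)]
  by_cases h0 : b 0 - a 0 = 0
  · by_cases h1 : b 1 - a 1 = 0
    · refine ⟨c - a, ?_⟩
      have hab : b = a := by
        ext i; fin_cases i
        · exact sub_eq_zero.mp h0
        · exact sub_eq_zero.mp h1
      rintro q (rfl | rfl | rfl)
      · exact ⟨0, by simp⟩
      · exact ⟨0, by simp [hab]⟩
      · exact ⟨1, by simp⟩
    · refine ⟨b - a, ?_⟩
      rintro q (rfl | rfl | rfl)
      · exact ⟨0, by simp⟩
      · exact ⟨1, by simp⟩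
      · refine ⟨(q 1 - a 1) / (b 1 - a 1), ?_⟩
        ext i; fin_cases i <;> simp <;> field_simp <;> linarith
  · refine ⟨b - a, ?_⟩
    rintro q (rfl | rfl | rfl)
    · exact ⟨0, by simp⟩
    · exact ⟨1, by simp⟩
    · refine ⟨(q 0 - a 0) / (b 0 - a 0), ?_⟩
      ext i; fin_cases i <;> simp <;> field_simp <;> linarith

theorem openSegment_inter_nonempty_of_orient {a b c d : EuclideanSpace ℝ (Fin 2)}
    (h₁ : orient a b c * orient a b d < 0) (h₂ : orient c d a * orient c d b < 0) :
    (openSegment ℝ a b ∩ openSegment ℝ c d).Nonempty := by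
  have weights : ∀ x y : ℝ, x * y < 0 → y - x ≠ 0 ∧ 0 < y / (y - x) ∧ 0 < -x / (y - x) := by
    intro x y h
    rcases mul_neg_iff.mp h with ⟨hx, hy⟩ | ⟨hx, hy⟩
    · have : y - x < 0 := by linarith
      exact ⟨this.ne, div_pos_of_neg_of_neg hy this, div_pos_of_neg_of_neg (by linarith) this⟩
    · have : 0 < y - x := by linarith
      exact ⟨this.ne', div_pos hy this, div_pos (by linarith) this⟩
  obtain ⟨hn₁, hc, hd⟩ := weights _ _ h₁
  obtain ⟨hn₂, ha, hb⟩ := weights _ _ h₂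
  refine ⟨_, ⟨_, _, ha, hb, by field_simp; ring, rfl⟩, ⟨_, _, hc, hd, by field_simp; ring, ?_⟩⟩
  ext i
  simp only [PiLp.add_apply, PiLp.smul_apply, smul_eq_mul]
  field_simp
  unfold orient
  fin_cases i <;> simp <;> ring

theorem mem_convexHull_triple_of_orient {a b c x : EuclideanSpace ℝ (Fin 2)}
    (h : orient a b c ≠ 0) (ha : 0 ≤ orient x b c / orient a b c)
    (hb : 0 ≤ orient a x c / orient a b c) (hc : 0 ≤ orient a b x / orient a b c) :
    x ∈ convexHull ℝ ({a, b, c} : Set (EuclideanSpace ℝ (Fin 2))) := by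
  have hsum : orient x b c / orient a b c + orient a x c / orient a b c
      + orient a b x / orient a b c = 1 := by
    field_simp; unfold orient; ring
  have hx : x = (orient x b c / orient a b c) • a + (orient a x c / orient a b c) • b
      + (orient a b x / orient a b c) • c := by
    ext i
    simp only [PiLp.add_apply, PiLp.smul_apply, smul_eq_mul]
    field_simp
    unfold orient
    fin_cases i <;> simp <;> ring
  have := (convex_convexHull ℝ ({a, b, c} : Set (EuclideanSpace ℝ (Fin 2)))).sum_mem
    (t := Finset.univ) (z := ![a, b, c])
    (w := ![orient x b c / orient a b c, orient a x c / orient a b c, orient a b x / orient a b c])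
    (by intro i _; fin_cases i <;> assumption)
    (by simpa [Fin.sum_univ_three] using hsum)
    (by intro i _; apply subset_convexHull; fin_cases i <;> simp)
  rw [hx]
  simpa [Fin.sum_univ_three] using this

theorem convex_setOf_orient_div_nonneg (a b : EuclideanSpace ℝ (Fin 2)) (r : ℝ) :
    Convex ℝ {x | 0 ≤ orient a b x / r} := by
  intro x hx y hy s t hs ht hst
  have : orient a b (s • x + t • y) / r = s * (orient a b x / r) + t * (orient a b y / r) := by
    obtain rfl : s = 1 - t := by linarith
    simp only [orient, PiLp.add_apply, PiLp.smul_apply, smul_eq_mul]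
    ring
  simp only [Set.mem_ofPred_eq] at hx hy ⊢
  rw [this]
  positivity

theorem orient_div_nonneg_of_mem_convexHull {a b c x : EuclideanSpace ℝ (Fin 2)}
    (hx : x ∈ convexHull ℝ ({a, b, c} : Set (EuclideanSpace ℝ (Fin 2)))) :
    0 ≤ orient a b x / orient a b c := by
  refine convexHull_min ?_ (convex_setOf_orient_div_nonneg a b _) hx
  rintro y (rfl | rfl | rfl)
  · simp [orient]
  · simp [orient, mul_comm]
  · by_cases h : orient a b y = 0 <;> simp [h]

theorem continuous_orient {f g h : EuclideanSpace ℝ (Fin 2) → EuclideanSpace ℝ (Fin 2)}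
    (hf : Continuous f) (hg : Continuous g) (hh : Continuous h) :
    Continuous fun x ↦ orient (f x) (g x) (h x) := by
  unfold orient; fun_prop

theorem mem_interior_convexHull_triple_iff {a b c x : EuclideanSpace ℝ (Fin 2)}
    (h : orient a b c ≠ 0) (ha : orient x b c ≠ 0) (hb : orient a x c ≠ 0)
    (hc : orient a b x ≠ 0) :
    x ∈ interior (convexHull ℝ ({a, b, c} : Set (EuclideanSpace ℝ (Fin 2)))) ↔
      0 < orient x b c / orient a b c ∧ 0 < orient a x c / orient a b c ∧
        0 < orient a b x / orient a b c := by
  constructor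
  · intro hx
    have hx := interior_subset hx
    refine ⟨lt_of_le_of_ne ?_ (div_ne_zero ha h).symm, lt_of_le_of_ne ?_ (div_ne_zero hb h).symm,
      lt_of_le_of_ne ?_ (div_ne_zero hc h).symm⟩
    · rw [← orient_rotate x b c, ← orient_rotate a b c]
      refine orient_div_nonneg_of_mem_convexHull ?_
      convert hx using 2
      ext y; simp; tauto
    · rw [orient_swap_right a c x, orient_swap_right a c b, neg_div_neg_eq]
      refine orient_div_nonneg_of_mem_convexHull ?_
      rwa [Set.pair_comm]
    · exact orient_div_nonneg_of_mem_convexHull hx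
  · intro hx
    refine interior_maximal (t := {y | 0 < orient y b c / orient a b c ∧
      0 < orient a y c / orient a b c ∧ 0 < orient a b y / orient a b c}) ?_ ?_ hx
    · rintro y ⟨h₁, h₂, h₃⟩
      exact mem_convexHull_triple_of_orient h h₁.le h₂.le h₃.le
    · have key : ∀ f g k : EuclideanSpace ℝ (Fin 2) → EuclideanSpace ℝ (Fin 2),
          Continuous f → Continuous g → Continuous k →
          IsOpen {y | 0 < orient (f y) (g y) (k y) / orient a b c} := fun f g k hf hg hk ↦
        isOpen_lt continuous_const ((continuous_orient hf hg hk).div_const _)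
      exact (key _ _ _ continuous_id continuous_const continuous_const).inter
        ((key _ _ _ continuous_const continuous_id continuous_const).inter
          (key _ _ _ continuous_const continuous_const continuous_id))

theorem mul_neg_of_decide_pos_ne {x y : ℝ} (hx : x ≠ 0) (hy : y ≠ 0)
    (h : decide (0 < x) ≠ decide (0 < y)) : x * y < 0 := by
  rcases hx.lt_or_gt with hx | hx <;> rcases hy.lt_or_gt with hy | hy
  · simp [hx.not_gt, hy.not_gt] at h
  · exact mul_neg_of_neg_of_pos hx hy
  · exact mul_neg_of_pos_of_neg hx hy
  · simp [hx, hy] at h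

theorem mul_pos_of_decide_pos_eq {x y : ℝ} (hx : x ≠ 0) (hy : y ≠ 0)
    (h : decide (0 < x) = decide (0 < y)) : 0 < x * y := by
  rcases hx.lt_or_gt with hx | hx <;> rcases hy.lt_or_gt with hy | hy
  · exact mul_pos_of_neg_of_neg hx hy
  · simp [hx.not_gt, hy] at h
  · simp [hx, hy.not_gt] at h
  · exact mul_pos hx hy

section Quadruple

variable {a b c d : EuclideanSpace ℝ (Fin 2)}

theorem decide_orient_of_disjoint_ab_cd (habc : orient a b c ≠ 0) (habd : orient a b d ≠ 0)
    (hacd : orient a c d ≠ 0) (hbcd : orient b c d ≠ 0)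
    (h : openSegment ℝ a b ∩ openSegment ℝ c d = ∅) :
    decide (0 < orient a b c) = decide (0 < orient a b d) ∨
      decide (0 < orient a c d) = decide (0 < orient b c d) := by
  by_contra! hne
  refine (openSegment_inter_nonempty_of_orient
    (mul_neg_of_decide_pos_ne habc habd hne.1) ?_).ne_empty h
  rw [orient_rotate a c d, orient_rotate b c d]
  exact mul_neg_of_decide_pos_ne hacd hbcd hne.2

theorem decide_orient_of_disjoint_ac_bd (habc : orient a b c ≠ 0) (habd : orient a b d ≠ 0)
    (hacd : orient a c d ≠ 0) (hbcd : orient b c d ≠ 0)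
    (h : openSegment ℝ a c ∩ openSegment ℝ b d = ∅) :
    decide (0 < orient a b c) ≠ decide (0 < orient a c d) ∨
      decide (0 < orient a b d) ≠ decide (0 < orient b c d) := by
  by_contra! heq
  have h₁ := mul_pos_of_decide_pos_eq habc hacd heq.1
  have h₂ := mul_pos_of_decide_pos_eq habd hbcd heq.2
  refine (openSegment_inter_nonempty_of_orient ?_ ?_).ne_empty h
  · rw [orient_swap_right a b c]; linarith
  · rw [orient_rotate a b d, orient_swap_right b c d]; linarith

theorem decide_orient_of_disjoint_ad_bc (habc : orient a b c ≠ 0) (habd : orient a b d ≠ 0)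
    (hacd : orient a c d ≠ 0) (hbcd : orient b c d ≠ 0)
    (h : openSegment ℝ a d ∩ openSegment ℝ b c = ∅) :
    decide (0 < orient a b d) = decide (0 < orient a c d) ∨
      decide (0 < orient a b c) = decide (0 < orient b c d) := by
  by_contra! hne
  have h₁ := mul_neg_of_decide_pos_ne habd hacd hne.1
  have h₂ := mul_neg_of_decide_pos_ne habc hbcd hne.2
  refine (openSegment_inter_nonempty_of_orient ?_ ?_).ne_empty h
  · rw [orient_swap_right a b d, orient_swap_right a c d]; linarith
  · rwa [orient_rotate a b c]

end Quadruple

/-- The sign condition imposed by a three-term relation between products of nonzero reals. -/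
theorem decide_pos_of_mul_add_mul_eq {x₁ x₂ y₁ y₂ z₁ z₂ : ℝ} (hx₁ : x₁ ≠ 0) (hx₂ : x₂ ≠ 0)
    (hy₁ : y₁ ≠ 0) (hy₂ : y₂ ≠ 0) (hz₁ : z₁ ≠ 0) (hz₂ : z₂ ≠ 0)
    (h : x₁ * x₂ + z₁ * z₂ = y₁ * y₂) :
    ¬(decide (0 < x₁) = decide (0 < x₂) ∧ decide (0 < z₁) = decide (0 < z₂) ∧
        decide (0 < y₁) ≠ decide (0 < y₂)) ∧
      ¬(decide (0 < x₁) ≠ decide (0 < x₂) ∧ decide (0 < z₁) ≠ decide (0 < z₂) ∧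
        decide (0 < y₁) = decide (0 < y₂)) := by
  constructor
  · rintro ⟨hx, hz, hy⟩
    linarith [mul_pos_of_decide_pos_eq hx₁ hx₂ hx, mul_pos_of_decide_pos_eq hz₁ hz₂ hz,
      mul_neg_of_decide_pos_ne hy₁ hy₂ hy]
  · rintro ⟨hx, hz, hy⟩
    linarith [mul_neg_of_decide_pos_ne hx₁ hx₂ hx, mul_neg_of_decide_pos_ne hz₁ hz₂ hz,
      mul_pos_of_decide_pos_eq hy₁ hy₂ hy]

theorem div_pos_iff_decide_pos_eq {x y : ℝ} (hx : x ≠ 0) (hy : y ≠ 0) :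
    0 < x / y ↔ decide (0 < x) = decide (0 < y) := by
  refine ⟨fun h ↦ ?_, fun h ↦ ?_⟩
  · by_contra hne
    have := mul_neg_of_decide_pos_ne hx hy hne
    rcases div_pos_iff.mp h with h | h <;> nlinarith
  · rw [← mul_div_mul_right x y hy]
    exact div_pos (mul_pos_of_decide_pos_eq hx hy h) (mul_self_pos.mpr hy)

/-- If no 3 of 5 points in the plane are collinear, and the open segments joining the
points (other than the segment `p 0`–`p 1`) are pairwise disjoint, then exactly one of
the points `p 0`, `p 1` lies in the interior of the triangle `p 2 p 3 p 4`. -/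
theorem stmt_4 (p : Fin 5 → EuclideanSpace ℝ (Fin 2))
    (hcol : ∀ i j k : Fin 5, i ≠ j → i ≠ k → j ≠ k →
      ¬ Collinear ℝ ({p i, p j, p k} : Set (EuclideanSpace ℝ (Fin 2))))
    (hdisj : ∀ i j k l : Fin 5, i ≠ j → k ≠ l →
      ({i, j} : Finset (Fin 5)) ≠ ({k, l} : Finset (Fin 5)) →
      ({i, j} : Finset (Fin 5)) ≠ ({0, 1} : Finset (Fin 5)) →
      ({k, l} : Finset (Fin 5)) ≠ ({0, 1} : Finset (Fin 5)) →
      openSegment ℝ (p i) (p j) ∩ openSegment ℝ (p k) (p l) = ∅) :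
    Xor' (p 0 ∈ interior (convexHull ℝ ({p 2, p 3, p 4} : Set (EuclideanSpace ℝ (Fin 2)))))
      (p 1 ∈ interior (convexHull ℝ ({p 2, p 3, p 4} : Set (EuclideanSpace ℝ (Fin 2))))) := by
  have hp : ∀ i j k : Fin 5, i ≠ j → i ≠ k → j ≠ k → orient (p i) (p j) (p k) ≠ 0 :=
    fun i j k hij hik hjk h ↦ hcol i j k hij hik hjk (collinear_of_orient_eq_zero h)
  have h012 := hp 0 1 2 (by decide) (by decide) (by decide)
  have h013 := hp 0 1 3 (by decide) (by decide) (by decide)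
  have h014 := hp 0 1 4 (by decide) (by decide) (by decide)
  have h023 := hp 0 2 3 (by decide) (by decide) (by decide)
  have h024 := hp 0 2 4 (by decide) (by decide) (by decide)
  have h034 := hp 0 3 4 (by decide) (by decide) (by decide)
  have h123 := hp 1 2 3 (by decide) (by decide) (by decide)
  have h124 := hp 1 2 4 (by decide) (by decide) (by decide)
  have h134 := hp 1 3 4 (by decide) (by decide) (by decide)
  have h234 := hp 2 3 4 (by decide) (by decide) (by decide)
  have c02_13 := decide_orient_of_disjoint_ac_bd h012 h013 h023 h123
    (hdisj 0 2 1 3 (by decide) (by decide) (by decide) (by decide) (by decide))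
  have c03_12 := decide_orient_of_disjoint_ad_bc h012 h013 h023 h123
    (hdisj 0 3 1 2 (by decide) (by decide) (by decide) (by decide) (by decide))
  have c02_14 := decide_orient_of_disjoint_ac_bd h012 h014 h024 h124
    (hdisj 0 2 1 4 (by decide) (by decide) (by decide) (by decide) (by decide))
  have c04_12 := decide_orient_of_disjoint_ad_bc h012 h014 h024 h124
    (hdisj 0 4 1 2 (by decide) (by decide) (by decide) (by decide) (by decide))
  have c03_14 := decide_orient_of_disjoint_ac_bd h013 h014 h034 h134
    (hdisj 0 3 1 4 (by decide) (by decide) (by decide) (by decide) (by decide))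
  have c04_13 := decide_orient_of_disjoint_ad_bc h013 h014 h034 h134
    (hdisj 0 4 1 3 (by decide) (by decide) (by decide) (by decide) (by decide))
  have c02_34 := decide_orient_of_disjoint_ab_cd h023 h024 h034 h234
    (hdisj 0 2 3 4 (by decide) (by decide) (by decide) (by decide) (by decide))
  have c03_24 := decide_orient_of_disjoint_ac_bd h023 h024 h034 h234
    (hdisj 0 3 2 4 (by decide) (by decide) (by decide) (by decide) (by decide))
  have c04_23 := decide_orient_of_disjoint_ad_bc h023 h024 h034 h234
    (hdisj 0 4 2 3 (by decide) (by decide) (by decide) (by decide) (by decide))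
  have c12_34 := decide_orient_of_disjoint_ab_cd h123 h124 h134 h234
    (hdisj 1 2 3 4 (by decide) (by decide) (by decide) (by decide) (by decide))
  have c13_24 := decide_orient_of_disjoint_ac_bd h123 h124 h134 h234
    (hdisj 1 3 2 4 (by decide) (by decide) (by decide) (by decide) (by decide))
  have c14_23 := decide_orient_of_disjoint_ad_bc h123 h124 h134 h234
    (hdisj 1 4 2 3 (by decide) (by decide) (by decide) (by decide) (by decide))
  have g2 := decide_pos_of_mul_add_mul_eq h012 h234 h023 h124 h024 h123
    (by unfold orient; ring)
  have g3 := decide_pos_of_mul_add_mul_eq h013 h234 h023 h134 h034 h123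
    (by unfold orient; ring)
  have g4 := decide_pos_of_mul_add_mul_eq h014 h234 h024 h134 h034 h124
    (by unfold orient; ring)
  have h204 := hp 2 0 4 (by decide) (by decide) (by decide)
  have h230 := hp 2 3 0 (by decide) (by decide) (by decide)
  have h214 := hp 2 1 4 (by decide) (by decide) (by decide)
  have h231 := hp 2 3 1 (by decide) (by decide) (by decide)
  rw [mem_interior_convexHull_triple_iff h234 h034 h204 h230,
    mem_interior_convexHull_triple_iff h234 h134 h214 h231,
    div_pos_iff_decide_pos_eq h034 h234, div_pos_iff_decide_pos_eq h204 h234,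
    div_pos_iff_decide_pos_eq h230 h234, div_pos_iff_decide_pos_eq h134 h234,
    div_pos_iff_decide_pos_eq h214 h234, div_pos_iff_decide_pos_eq h231 h234]
  have swap : ∀ i j k : Fin 5, orient (p i) (p j) (p k) ≠ 0 →
      decide (0 < orient (p j) (p i) (p k)) = !decide (0 < orient (p i) (p j) (p k)) := by
    intro i j k h
    have hneg : orient (p j) (p i) (p k) = -orient (p i) (p j) (p k) := by unfold orient; ring
    rw [hneg]
    rcases h.lt_or_gt with h | h <;> simp [h, h.not_gt]
  rw [swap 0 2 4 h024, swap 1 2 4 h124, orient_rotate (p 0), orient_rotate (p 1)]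
  clear swap hp hdisj hcol h012 h013 h014 h023 h024 h034 h123 h124 h134 h234
    h204 h230 h214 h231
  generalize decide (0 < orient (p 0) (p 1) (p 2)) = s012 at *
  generalize decide (0 < orient (p 0) (p 1) (p 3)) = s013 at *
  generalize decide (0 < orient (p 0) (p 1) (p 4)) = s014 at *
  generalize decide (0 < orient (p 0) (p 2) (p 3)) = s023 at *
  generalize decide (0 < orient (p 0) (p 2) (p 4)) = s024 at *
  generalize decide (0 < orient (p 0) (p 3) (p 4)) = s034 at *
  generalize decide (0 < orient (p 1) (p 2) (p 3)) = s123 at *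
  generalize decide (0 < orient (p 1) (p 2) (p 4)) = s124 at *
  generalize decide (0 < orient (p 1) (p 3) (p 4)) = s134 at *
  generalize decide (0 < orient (p 2) (p 3) (p 4)) = s234 at *
  unfold Xor'
  cases s234 <;> cases s023 <;> grind
end

section
/- Let p₁, p₂, p₃, p₄ be 4 pairwise distinct points in the plane ℝ² such that no three of them are collinear. Then there exists a unique subset S of the index set {1,2,3,4} containing the index 1 such that the convex hull of {p_i : i ∈ S} and the convex hull of {p_i : i ∉ S} have a common point (their intersection is nonempty). -/
/-- Every point of the convex hull of `p '' S` is a convex combination of the family `p` with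
weights supported in `S`. -/
theorem exists_weights_of_mem_convexHull_image {ι E : Type*} [Fintype ι] [AddCommGroup E]
    [Module ℝ E] {p : ι → E} {S : Set ι} {x : E} (hx : x ∈ convexHull ℝ (p '' S)) :
    ∃ w : ι → ℝ, (∀ i, 0 ≤ w i) ∧ (∀ i ∉ S, w i = 0) ∧ ∑ i, w i = 1 ∧ ∑ i, w i • p i = x := by
  classical
  refine convexHull_min (t := {x | ∃ w : ι → ℝ, (∀ i, 0 ≤ w i) ∧ (∀ i ∉ S, w i = 0) ∧
    ∑ i, w i = 1 ∧ ∑ i, w i • p i = x}) ?_ ?_ hx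
  · rintro _ ⟨i, hi, rfl⟩
    refine ⟨Pi.single i 1, fun j ↦ ?_, fun j hj ↦ ?_, by simp, by simp [Pi.single_apply]⟩
    · by_cases h : j = i <;> simp [h]
    · exact Pi.single_eq_of_ne (by rintro rfl; exact hj hi) 1
  · rintro _ ⟨v, hv, hvS, hv1, rfl⟩ _ ⟨w, hw, hwS, hw1, rfl⟩ a b ha hb hab
    refine ⟨fun i ↦ a * v i + b * w i, fun i ↦ ?_, fun i hi ↦ ?_, ?_, ?_⟩
    · have := hv i
      have := hw i
      positivity
    · simp [hvS i hi, hwS i hi]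
    · rw [Finset.sum_add_distrib, ← Finset.mul_sum, ← Finset.mul_sum, hv1, hw1]
      linarith
    · simp only [add_smul, mul_smul, Finset.sum_add_distrib, Finset.smul_sum]

/-- A common point of the convex hulls of the two parts of a partition yields a nontrivial affine
dependence whose signs are determined by the partition. -/
theorem exists_affine_dependence_of_convexHull_inter {ι E : Type*} [Fintype ι] [AddCommGroup E]
    [Module ℝ E] {p : ι → E} {S : Set ι}
    (hS : (convexHull ℝ (p '' S) ∩ convexHull ℝ (p '' Sᶜ)).Nonempty) :
    ∃ w : ι → ℝ, w ≠ 0 ∧ ∑ i, w i = 0 ∧ ∑ i, w i • p i = 0 ∧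
      (∀ i ∈ S, 0 ≤ w i) ∧ ∀ i ∉ S, w i ≤ 0 := by
  obtain ⟨x, hx, hx'⟩ := hS
  obtain ⟨u, hu, huS, hu1, hux⟩ := exists_weights_of_mem_convexHull_image hx
  obtain ⟨v, hv, hvS, hv1, hvx⟩ := exists_weights_of_mem_convexHull_image hx'
  have hv0 : ∀ i ∈ S, v i = 0 := fun i hi ↦ hvS i (not_not.mpr hi)
  refine ⟨u - v, fun h ↦ ?_, ?_, ?_, fun i hi ↦ ?_, fun i hi ↦ ?_⟩
  · have hu0 : ∀ i, u i = 0 := fun i ↦ by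
      by_cases hi : i ∈ S
      · rw [sub_eq_zero.mp h, hv0 i hi]
      · exact huS i hi
    simp [hu0] at hu1
  · simp [Finset.sum_sub_distrib, hu1, hv1]
  · simp [sub_smul, Finset.sum_sub_distrib, hux, hvx]
  · simp [hv0 i hi, hu i]
  · simp [huS i hi, hv i]

/-- If omitting any one point of a finite family leaves an affinely independent family, then an
affine dependence with a vanishing coefficient is trivial. -/
theorem affine_dependence_eq_zero_of_apply_eq_zero {n : ℕ} {E : Type*} [AddCommGroup E]
    [Module ℝ E] {p : Fin (n + 1) → E}
    (hp : ∀ k : Fin (n + 1), AffineIndependent ℝ (p ∘ k.succAbove))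
    {w : Fin (n + 1) → ℝ} (hw : ∑ i, w i = 0) (hwp : ∑ i, w i • p i = 0) {k : Fin (n + 1)}
    (hk : w k = 0) : w = 0 := by
  rw [Fin.sum_univ_succAbove _ k, hk, zero_add] at hw
  rw [Fin.sum_univ_succAbove _ k, hk, zero_smul, zero_add] at hwp
  have h := affineIndependent_iff.mp (hp k) Finset.univ (w ∘ k.succAbove) hw hwp
  ext i
  rcases Fin.eq_self_or_eq_succAbove k i with rfl | ⟨j, rfl⟩
  · exact hk
  · exact h j (Finset.mem_univ j)

/-- If omitting any one point of a finite family leaves an affinely independent family, then the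
family has at most one Radon partition. -/
theorem radon_partition_unique {n : ℕ} {E : Type*} [AddCommGroup E] [Module ℝ E]
    {p : Fin (n + 1) → E} (hp : ∀ k : Fin (n + 1), AffineIndependent ℝ (p ∘ k.succAbove))
    {S T : Set (Fin (n + 1))} {k : Fin (n + 1)} (hkS : k ∈ S) (hkT : k ∈ T)
    (hS : (convexHull ℝ (p '' S) ∩ convexHull ℝ (p '' Sᶜ)).Nonempty)
    (hT : (convexHull ℝ (p '' T) ∩ convexHull ℝ (p '' Tᶜ)).Nonempty) : S = T := by
  obtain ⟨v, hv, hv0, hvp, hvS, hvS'⟩ := exists_affine_dependence_of_convexHull_inter hS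
  obtain ⟨w, hw, hw0, hwp, hwT, hwT'⟩ := exists_affine_dependence_of_convexHull_inter hT
  have hv_ne : ∀ i, v i ≠ 0 := fun i hi ↦
    hv (affine_dependence_eq_zero_of_apply_eq_zero hp hv0 hvp hi)
  have hw_ne : ∀ i, w i ≠ 0 := fun i hi ↦
    hw (affine_dependence_eq_zero_of_apply_eq_zero hp hw0 hwp hi)
  have hvk : 0 < v k := (hvS k hkS).lt_of_ne' (hv_ne k)
  have hwk : 0 < w k := (hwT k hkT).lt_of_ne' (hw_ne k)
  have hprop : (fun i ↦ w k * v i - v k * w i) = 0 := by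
    refine affine_dependence_eq_zero_of_apply_eq_zero hp ?_ ?_ (k := k) (by ring)
    · rw [Finset.sum_sub_distrib, ← Finset.mul_sum, ← Finset.mul_sum, hv0, hw0]
      simp
    · simp only [sub_smul, mul_smul, Finset.sum_sub_distrib, ← Finset.smul_sum, hvp, hwp]
      simp
  have hpos : ∀ i, 0 < v i ↔ 0 < w i := fun i ↦ by
    have h : w k * v i = v k * w i := sub_eq_zero.mp (congrFun hprop i)
    rw [← mul_pos_iff_of_pos_left hwk, h, mul_pos_iff_of_pos_left hvk]
  have hSv : ∀ i, i ∈ S ↔ 0 < v i := fun i ↦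
    ⟨fun hi ↦ (hvS i hi).lt_of_ne' (hv_ne i), fun h ↦ by_contra fun hi ↦ (hvS' i hi).not_gt h⟩
  have hTw : ∀ i, i ∈ T ↔ 0 < w i := fun i ↦
    ⟨fun hi ↦ (hwT i hi).lt_of_ne' (hw_ne i), fun h ↦ by_contra fun hi ↦ (hwT' i hi).not_gt h⟩
  ext i
  rw [hSv, hTw, hpos]

/-- Uniqueness of the Radon partition of 4 points in general position in the plane:
there exists a unique subset `S` of the indices containing the first index such that the
convex hulls of the points indexed by `S` and by its complement intersect. -/
theorem stmt_5 (p : Fin 4 → EuclideanSpace ℝ (Fin 2)) (hp : Function.Injective p)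
    (hcol : ∀ i j k : Fin 4, i ≠ j → i ≠ k → j ≠ k →
      ¬ Collinear ℝ ({p i, p j, p k} : Set (EuclideanSpace ℝ (Fin 2)))) :
    ∃! S : Set (Fin 4), (0 : Fin 4) ∈ S ∧
      (convexHull ℝ (p '' S) ∩ convexHull ℝ (p '' Sᶜ)).Nonempty := by
  have hind : ∀ k : Fin 4, AffineIndependent ℝ (p ∘ k.succAbove) := fun k ↦ by
    have hne : ∀ i j : Fin 3, i ≠ j → k.succAbove i ≠ k.succAbove j := fun i j h ↦
      Fin.succAbove_right_injective.ne h
    have h := affineIndependent_iff_not_collinear_set.mpr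
      (hcol _ _ _ (hne 0 1 (by decide)) (hne 0 2 (by decide)) (hne 1 2 (by decide)))
    have heq : p ∘ k.succAbove =
        ![p (k.succAbove 0), p (k.succAbove 1), p (k.succAbove 2)] := by
      funext i
      fin_cases i <;> rfl
    rwa [heq]
  have hdep : ¬ AffineIndependent ℝ p := by
    rw [← finrank_vectorSpan_le_iff_not_affineIndependent ℝ p (n := 2) (by simp)]
    exact (Submodule.finrank_le _).trans (by simp)
  obtain ⟨I, hI⟩ := Convex.radon_partition hdep
  obtain ⟨S, h0S, hS⟩ : ∃ S : Set (Fin 4), (0 : Fin 4) ∈ S ∧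
      (convexHull ℝ (p '' S) ∩ convexHull ℝ (p '' Sᶜ)).Nonempty := by
    by_cases h0 : (0 : Fin 4) ∈ I
    · exact ⟨I, h0, hI⟩
    · exact ⟨Iᶜ, h0, by rwa [compl_compl, Set.inter_comm]⟩
  exact ⟨S, ⟨h0S, hS⟩, fun T ⟨h0T, hT⟩ ↦ radon_partition_unique hind h0T h0S hT hS⟩
end

section
/- (Tverberg theorem in the plane.) For every positive integer r, any 3r−2 pairwise distinct points in the plane can be decomposed into r disjoint groups whose convex hulls have a common point: for every injective p : Fin (3r−2) → ℝ² there exists an assignment c : Fin (3r−2) → Fin r such that the intersection over all s ∈ Fin r of convexHull ℝ (p '' {i : c i = s}) is nonempty. -/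
open Finset Module
open scoped RealInnerProductSpace

/-- A point in the convex hull of a finite family is a convex combination of the whole family. -/
theorem exists_mem_stdSimplex_of_mem_convexHull_range {ι E : Type*} [Fintype ι]
    [AddCommGroup E] [Module ℝ E] {f : ι → E} {x : E} (hx : x ∈ convexHull ℝ (Set.range f)) :
    ∃ w ∈ stdSimplex ℝ ι, ∑ i, w i • f i = x := by
  classical
  have hconv : Convex ℝ (Fintype.linearCombination ℝ f '' stdSimplex ℝ ι) :=
    (convex_stdSimplex ℝ ι).linear_image _
  have hsub : Set.range f ⊆ Fintype.linearCombination ℝ f '' stdSimplex ℝ ι := by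
    rintro _ ⟨i, rfl⟩
    exact ⟨Pi.single i 1, single_mem_stdSimplex ℝ i, by simp⟩
  obtain ⟨w, hw, rfl⟩ := convexHull_min hsub hconv hx
  exact ⟨w, hw, by simp [Fintype.linearCombination_apply]⟩

section InnerProductSpace

variable {E : Type*} [NormedAddCommGroup E] [InnerProductSpace ℝ E]

/-- A point of minimal norm in a convex set determines a supporting half-space. -/
theorem Convex.inner_self_le_inner_of_forall_norm_le {K : Set E} (hK : Convex ℝ K) {z : E}
    (hz : z ∈ K) (hmin : ∀ y ∈ K, ‖z‖ ≤ ‖y‖) {y : E} (hy : y ∈ K) : ⟪z, z⟫ ≤ ⟪z, y⟫ := by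
  have : Nonempty K := ⟨⟨z, hz⟩⟩
  have heq : ‖(0 : E) - z‖ = ⨅ w : K, ‖(0 : E) - w‖ := by
    refine le_antisymm (le_ciInf fun w => ?_)
      (ciInf_le ⟨0, Set.forall_mem_range.2 fun _ => norm_nonneg _⟩ (⟨z, hz⟩ : K))
    simpa using hmin w w.2
  have h := (norm_eq_iInf_iff_real_inner_le_zero hK hz).1 heq y hy
  simp only [zero_sub, inner_neg_left, inner_sub_right] at h
  linarith

/-- An affinely independent family on an affine hyperplane missing the origin is linearly
independent. -/
theorem AffineIndependent.linearIndependent_of_inner_eq {κ : Type*} {v : κ → E}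
    (hv : AffineIndependent ℝ v) {z : E} {a : ℝ} (ha : a ≠ 0) (hz : ∀ k, ⟪z, v k⟫ = a) :
    LinearIndependent ℝ v := by
  rw [linearIndependent_iff']
  intro s w hw
  refine affineIndependent_iff.1 hv s w ?_ hw
  have h := congrArg (inner ℝ z) hw
  simp only [inner_sum, inner_smul_right, hz, inner_zero_right, ← Finset.sum_mul] at h
  exact (mul_eq_zero.1 h).resolve_right ha

/-- If `z ≠ 0` supports the convex hull of more than `finrank ℝ E` points and lies in it, then
one of the points is not needed. -/
theorem exists_mem_convexHull_image_compl_singleton {ι : Type*} [Fintype ι]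
    [FiniteDimensional ℝ E] (hcard : finrank ℝ E < Fintype.card ι) {g : ι → E} {z : E}
    (hz0 : z ≠ 0) (hz : z ∈ convexHull ℝ (Set.range g)) (hsupp : ∀ i, ⟪z, z⟫ ≤ ⟪z, g i⟫) :
    ∃ i, z ∈ convexHull ℝ (g '' {i}ᶜ) := by
  classical
  obtain ⟨κ, _, v, w, hvg, hind, hwpos, hwsum, hwz⟩ := eq_pos_convex_span_of_mem_convexHull hz
  have hle : ∀ k, ⟪z, z⟫ ≤ ⟪z, v k⟫ := fun k => by
    obtain ⟨i, hi⟩ := hvg ⟨k, rfl⟩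
    exact hi ▸ hsupp i
  have hsum : ∑ k, w k * ⟪z, z⟫ = ∑ k, w k * ⟪z, v k⟫ := by
    rw [← Finset.sum_mul, hwsum, one_mul]
    simpa only [inner_sum, inner_smul_right] using congrArg (inner ℝ z) hwz.symm
  have heq : ∀ k, ⟪z, v k⟫ = ⟪z, z⟫ := fun k =>
    (mul_left_cancel₀ (hwpos k).ne' ((Finset.sum_eq_sum_iff_of_le fun k _ =>
      mul_le_mul_of_nonneg_left (hle k) (hwpos k).le).1 hsum k (Finset.mem_univ k))).symm
  have hlin := hind.linearIndependent_of_inner_eq (inner_self_ne_zero.2 hz0) heq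
  choose j hj using fun k => hvg ⟨k, rfl⟩
  have hnot : ¬ Function.Surjective j := fun h =>
    (hlin.fintype_card_le_finrank.trans_lt hcard).not_ge (Fintype.card_le_of_surjective j h)
  simp only [Function.Surjective, not_forall, not_exists] at hnot
  obtain ⟨i, hi⟩ := hnot
  exact ⟨i, mem_convexHull_of_exists_fintype w v (fun k => (hwpos k).le) hwsum
    (fun k => ⟨j k, hi k, hj k⟩) hwz⟩

/-- Bárány's colorful Carathéodory theorem. -/
theorem exists_zero_mem_convexHull_range_of_forall {ι κ : Type*} [Fintype ι] [Finite κ]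
    [Nonempty κ] [FiniteDimensional ℝ E] (hcard : finrank ℝ E < Fintype.card ι) (f : ι → κ → E)
    (hf : ∀ i, 0 ∈ convexHull ℝ (Set.range (f i))) :
    ∃ c : ι → κ, 0 ∈ convexHull ℝ (Set.range fun i => f i (c i)) := by
  classical
  have : Nonempty ι := Fintype.card_pos_iff.1 (by omega)
  have hcomp : IsCompact (⋃ c : ι → κ, convexHull ℝ (Set.range fun i => f i (c i))) :=
    isCompact_iUnion fun c => (Set.finite_range _).isCompact_convexHull ℝ
  have hne : (⋃ c : ι → κ, convexHull ℝ (Set.range fun i => f i (c i))).Nonempty :=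
    Set.nonempty_iUnion.2
      ⟨fun _ => Classical.arbitrary κ, (Set.range_nonempty _).convexHull⟩
  obtain ⟨z, hz, hmin⟩ := hcomp.exists_isMinOn hne continuous_norm.continuousOn
  have hsupp : ∀ c : ι → κ, z ∈ convexHull ℝ (Set.range fun i => f i (c i)) →
      ∀ i, ⟪z, z⟫ ≤ ⟪z, f i (c i)⟫ := fun c hc i =>
    (convex_convexHull ℝ _).inner_self_le_inner_of_forall_norm_le hc
      (fun y hy => isMinOn_iff.1 hmin y (Set.mem_iUnion.2 ⟨c, hy⟩))
      (subset_convexHull ℝ _ ⟨i, rfl⟩)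
  obtain ⟨c, hc⟩ := Set.mem_iUnion.1 hz
  by_cases hz0 : z = 0
  · exact ⟨c, hz0 ▸ hc⟩
  exfalso
  obtain ⟨i, hi⟩ := exists_mem_convexHull_image_compl_singleton hcard hz0 hc (hsupp c hc)
  have hpos : 0 < ⟪z, z⟫ := real_inner_self_pos.2 hz0
  have hupd : ∀ k, ⟪z, z⟫ ≤ ⟪z, f i k⟫ := fun k => by
    have h := hsupp (Function.update c i k) (convexHull_mono ?_ hi) i
    · simpa using h
    · rintro _ ⟨j, hj, rfl⟩
      exact ⟨j, by simp [Function.update_of_ne hj]⟩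
  have hhalf : Convex ℝ {y | ⟪z, z⟫ ≤ ⟪z, y⟫} :=
    convex_halfSpace_ge (innerₛₗ ℝ z).isLinear _
  have h0 : ⟪z, z⟫ ≤ ⟪z, (0 : E)⟫ :=
    (convexHull_min (Set.range_subset_iff.2 hupd) hhalf :
      convexHull ℝ (Set.range (f i)) ⊆ {y | ⟪z, z⟫ ≤ ⟪z, y⟫}) (hf i)
  rw [inner_zero_right] at h0
  exact hpos.not_ge h0

end InnerProductSpace

/-- Sarkaria's tensor trick: `d * n + 1` vectors of `ℝ^d` with suitable nonnegative weights
split into `n + 1` groups having the same weighted sum. -/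
theorem exists_weights_sum_filter_eq {ι δ : Type*} [Fintype ι] [Fintype δ] (n : ℕ)
    (hcard : Fintype.card δ * n < Fintype.card ι) (x : ι → δ → ℝ) :
    ∃ c : ι → Fin (n + 1), ∃ w ∈ stdSimplex ℝ ι, ∀ a s,
      ∑ i with c i = s, w i * x i a = ∑ i with c i = Fin.last n, w i * x i a := by
  classical
  let v : Fin (n + 1) → Fin n → ℝ := fun s k =>
    (if s = k.castSucc then 1 else 0) - (if s = Fin.last n then 1 else 0)
  let f : ι → Fin (n + 1) → EuclideanSpace ℝ (δ × Fin n) := fun i s =>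
    WithLp.toLp 2 fun q => x i q.1 * v s q.2
  have hf : ∀ i, 0 ∈ convexHull ℝ (Set.range (f i)) := fun i => by
    refine mem_convexHull_of_exists_fintype (fun _ => ((n : ℝ) + 1)⁻¹) (f i)
      (fun _ => by positivity) ?_ (fun s => ⟨s, rfl⟩) ?_
    · simp only [sum_const, card_univ, Fintype.card_fin, nsmul_eq_mul]
      push_cast
      exact mul_inv_cancel₀ (by positivity)
    · ext q
      simp [f, v, ← Finset.mul_sum]
  obtain ⟨c, hc⟩ := exists_zero_mem_convexHull_range_of_forall (by simpa using hcard) f hf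
  obtain ⟨w, hw, hw0⟩ := exists_mem_stdSimplex_of_mem_convexHull_range hc
  refine ⟨c, w, hw, fun a s => ?_⟩
  induction s using Fin.lastCases with
  | last => rfl
  | cast k =>
    have h := congrArg (fun y : EuclideanSpace ℝ (δ × Fin n) => y (a, k)) hw0
    simp only [f, v, WithLp.ofLp_sum, WithLp.ofLp_smul, Finset.sum_apply, Pi.smul_apply,
      smul_eq_mul, WithLp.ofLp_zero, Pi.zero_apply, mul_sub, mul_ite, mul_one, mul_zero,
      Finset.sum_sub_distrib, ← Finset.sum_filter] at h
    exact sub_eq_zero.1 h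

/-- Tverberg's theorem. -/
theorem exists_nonempty_iInter_convexHull_image {ι κ : Type*} [Fintype ι] [Fintype κ] (n : ℕ)
    (hcard : (Fintype.card κ + 1) * n < Fintype.card ι) (p : ι → EuclideanSpace ℝ κ) :
    ∃ c : ι → Fin (n + 1),
      (⋂ s : Fin (n + 1), convexHull ℝ (p '' {i | c i = s})).Nonempty := by
  classical
  obtain ⟨c, w, hw, h⟩ := exists_weights_sum_filter_eq n (δ := Option κ) (by simpa using hcard)
    fun i a => a.elim 1 (p i)
  have hmass : ∀ s, ∑ i with c i = s, w i = ∑ i with c i = Fin.last n, w i := fun s => by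
    simpa using h none s
  have htotal : ((n : ℝ) + 1) * ∑ i with c i = Fin.last n, w i = 1 := by
    have h1 := (Finset.sum_fiberwise univ c w).trans hw.2
    simpa only [hmass, sum_const, card_univ, Fintype.card_fin, nsmul_eq_mul, Nat.cast_add,
      Nat.cast_one] using h1
  have hpoint : ∀ s, ∑ i with c i = s, w i • p i = ∑ i with c i = Fin.last n, w i • p i :=
    fun s => by
      ext a
      simpa using h (some a) s
  refine ⟨c, ((n : ℝ) + 1) • ∑ i with c i = Fin.last n, w i • p i, Set.mem_iInter.2 fun s => ?_⟩
  rw [← hpoint s, Finset.smul_sum]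
  simp only [smul_smul]
  refine (convex_convexHull ℝ _).sum_mem (fun i _ => mul_nonneg (by positivity) (hw.1 i)) ?_
    fun i hi => subset_convexHull ℝ _ ⟨i, (Finset.mem_filter.1 hi).2, rfl⟩
  rw [← Finset.mul_sum, hmass, htotal]

/-- Tverberg theorem in the plane: for any `r > 0`, every `3r - 2` pairwise distinct
points in the plane can be decomposed into `r` disjoint groups whose convex hulls have a
common point. -/
theorem stmt_8 (r : ℕ) (hr : 0 < r) (p : Fin (3 * r - 2) → EuclideanSpace ℝ (Fin 2))
    (hp : Function.Injective p) :
    ∃ c : Fin (3 * r - 2) → Fin r,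
      (⋂ s : Fin r, convexHull ℝ (p '' {i | c i = s})).Nonempty := by
  obtain ⟨n, rfl⟩ := Nat.exists_eq_add_one.2 hr
  exact exists_nonempty_iInter_convexHull_image n (by simp only [Fintype.card_fin]; omega) p
end

section
/- (Tverberg theorem.) For all positive integers d and r, any (d+1)(r−1)+1 pairwise distinct points in ℝ^d can be decomposed into r disjoint groups whose convex hulls have a common point: for every injective p : Fin ((d+1)*(r−1)+1) → EuclideanSpace ℝ (Fin d) there exists an assignment c : Fin ((d+1)*(r−1)+1) → Fin r such that the intersection over all s ∈ Fin r of convexHull ℝ (p '' {i : c i = s}) is nonempty. -/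
theorem sq_norm_le_inner_of_forall_norm_le {V : Type*} [NormedAddCommGroup V]
    [InnerProductSpace ℝ V] {x y : V}
    (h : ∀ t : ℝ, 0 ≤ t → t ≤ 1 → ‖x‖ ≤ ‖(1 - t) • x + t • y‖) :
    ‖x‖ ^ 2 ≤ inner ℝ x y := by
  by_contra! hlt
  set a := inner ℝ x (y - x) with ha
  set b := ‖y - x‖ ^ 2 with hb
  have ha0 : a < 0 := by
    rw [ha, inner_sub_right, real_inner_self_eq_norm_sq]
    linarith
  have hb0 : 0 ≤ b := sq_nonneg _
  have hba : 0 < b - a := by linarith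
  set t := -a / (b - a) with ht
  have ht0 : 0 < t := div_pos (by linarith) hba
  have ht1 : t ≤ 1 := (div_le_one hba).2 (by linarith)
  have htba : t * (b - a) = -a := div_mul_cancel₀ _ hba.ne'
  have hsq : ‖(1 - t) • x + t • y‖ ^ 2 = ‖x‖ ^ 2 + 2 * t * a + t ^ 2 * b := by
    have : (1 - t) • x + t • y = x + t • (y - x) := by module
    rw [this, norm_add_sq_real, inner_smul_right, norm_smul, mul_pow, Real.norm_eq_abs, sq_abs]
    ring
  have hle := pow_le_pow_left₀ (norm_nonneg x) (h t ht0.le ht1) 2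
  rw [hsq] at hle
  nlinarith [mul_pos ht0 ht0, mul_pos ht0 (neg_pos.2 ha0)]

/-- Along an affine dependence, a point of the simplex can be moved until one of its
coordinates vanishes. -/
theorem exists_mem_stdSimplex_sub_smul_apply_eq_zero {ι : Type*} [Fintype ι] {w g : ι → ℝ}
    (hw : w ∈ stdSimplex ℝ ι) (hg : ∑ i, g i = 0) (hg0 : ∃ i, g i ≠ 0) :
    ∃ (a : ℝ) (k : ι), w - a • g ∈ stdSimplex ℝ ι ∧ (w - a • g) k = 0 := by
  classical
  obtain ⟨i₀, -, hi₀⟩ := Finset.exists_pos_of_sum_zero_of_exists_nonzero g hg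
    (by simpa using hg0)
  obtain ⟨k, hk, hmin⟩ := Finset.exists_min_image (Finset.univ.filter fun i ↦ 0 < g i)
    (fun i ↦ w i / g i) ⟨i₀, by simpa using hi₀⟩
  simp only [Finset.mem_filter, Finset.mem_univ, true_and] at hk hmin
  refine ⟨w k / g k, k, ⟨fun i ↦ ?_, ?_⟩, ?_⟩
  · simp only [Pi.sub_apply, Pi.smul_apply, smul_eq_mul, sub_nonneg]
    rcases lt_or_ge 0 (g i) with hi | hi
    · exact (le_div_iff₀ hi).1 (hmin i hi)
    · exact (mul_nonpos_of_nonneg_of_nonpos (div_nonneg (hw.1 k) hk.le) hi).trans (hw.1 i)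
  · simp [Finset.sum_sub_distrib, ← Finset.mul_sum, hg, hw.2]
  · simp [hk.ne']

/-- **Colorful Carathéodory theorem**, for colour classes that each sum to zero. -/
theorem exists_colorful_stdSimplex_sum_eq_zero {ι κ V : Type*} [Fintype ι] [Fintype κ]
    [Nonempty κ] [NormedAddCommGroup V] [InnerProductSpace ℝ V] [FiniteDimensional ℝ V]
    (hcard : Module.finrank ℝ V < Fintype.card ι) (v : ι → κ → V) (hv : ∀ i, ∑ j, v i j = 0) :
    ∃ (c : ι → κ) (w : ι → ℝ), w ∈ stdSimplex ℝ ι ∧ ∑ i, w i • v i (c i) = 0 := by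
  classical
  have : Nonempty ι := Fintype.card_pos_iff.1 (by omega)
  have hmin : ∀ c : ι → κ, ∃ w ∈ stdSimplex ℝ ι, ∀ w' ∈ stdSimplex ℝ ι,
      ‖∑ i, w i • v i (c i)‖ ≤ ‖∑ i, w' i • v i (c i)‖ := by
    intro c
    have hcont : Continuous fun w : ι → ℝ ↦ ‖∑ i, w i • v i (c i)‖ := by fun_prop
    obtain ⟨w, hw, hwmin⟩ := (isCompact_stdSimplex ℝ ι).exists_isMinOn
      ⟨_, single_mem_stdSimplex ℝ (Classical.arbitrary ι)⟩ hcont.continuousOn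
    exact ⟨w, hw, isMinOn_iff.1 hwmin⟩
  choose W hW hWmin using hmin
  obtain ⟨c, hc⟩ := Finite.exists_min fun c ↦ ‖∑ i, W c i • v i (c i)‖
  set x := ∑ i, W c i • v i (c i) with hx
  have hxmin : ∀ (c' : ι → κ), ∀ w ∈ stdSimplex ℝ ι, ‖x‖ ≤ ‖∑ i, w i • v i (c' i)‖ :=
    fun c' w hw ↦ (hc c').trans (hWmin c' w hw)
  have hinner : ∀ (c' : ι → κ), ∀ w ∈ stdSimplex ℝ ι, ∑ i, w i • v i (c' i) = x →
      ∀ k, ‖x‖ ^ 2 ≤ inner ℝ x (v k (c' k)) := by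
    intro c' w hw hwx k
    refine sq_norm_le_inner_of_forall_norm_le fun t ht0 ht1 ↦ ?_
    have hmem := convex_stdSimplex ℝ ι hw (single_mem_stdSimplex ℝ k) (sub_nonneg.2 ht1) ht0
      (sub_add_cancel 1 t)
    convert hxmin c' _ hmem using 2
    simp [add_smul, Finset.sum_add_distrib, mul_smul, ← Finset.smul_sum, hwx, Pi.single_apply]
  suffices hx0 : x = 0 from ⟨c, W c, hW c, hx0⟩
  -- It is enough to write `x` without using one of the colour classes.
  have hzero : ∀ w ∈ stdSimplex ℝ ι, ∑ i, w i • v i (c i) = x → ∀ k, w k = 0 → x = 0 := by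
    intro w hw hwx k hk
    have hj : ∀ j, ‖x‖ ^ 2 ≤ inner ℝ x (v k j) := by
      intro j
      have hsum : ∑ i, w i • v i (Function.update c k j i) = x := by
        rw [← hwx]
        refine Finset.sum_congr rfl fun i _ ↦ ?_
        by_cases hik : i = k
        · subst hik; simp [hk]
        · rw [Function.update_of_ne hik]
      simpa using hinner _ w hw hsum k
    have hsum := Finset.sum_le_sum fun j (_ : j ∈ Finset.univ) ↦ hj j
    rw [← inner_sum, hv, inner_zero_right, Finset.sum_const, nsmul_eq_mul, Finset.card_univ] at hsum
    have hκ : (0 : ℝ) < Fintype.card κ := by exact_mod_cast Fintype.card_pos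
    have := nonpos_of_mul_nonpos_right hsum hκ
    simpa using le_antisymm this (sq_nonneg _)
  by_cases hpos : ∃ k, W c k = 0
  · obtain ⟨k, hk⟩ := hpos
    exact hzero _ (hW c) rfl k hk
  push Not at hpos
  by_contra hx0
  have heq : ∀ i, inner ℝ x (v i (c i)) = ‖x‖ ^ 2 := by
    have hle := hinner c (W c) (hW c) rfl
    have hsum : ∑ i, W c i * (inner ℝ x (v i (c i)) - ‖x‖ ^ 2) = 0 := by
      simp_rw [mul_sub, Finset.sum_sub_distrib, ← Finset.sum_mul, (hW c).2, ← inner_smul_right]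
      rw [← inner_sum, ← hx, real_inner_self_eq_norm_sq]
      ring
    rw [Finset.sum_eq_zero_iff_of_nonneg fun i _ ↦
      mul_nonneg ((hW c).1 i) (sub_nonneg.2 (hle i))] at hsum
    intro i
    exact sub_eq_zero.1 ((mul_eq_zero.1 (hsum i (Finset.mem_univ i))).resolve_left (hpos i))
  have hdep : ¬ LinearIndependent ℝ fun i ↦ v i (c i) :=
    fun h ↦ hcard.not_ge h.fintype_card_le_finrank
  obtain ⟨g, hgv, hg0⟩ := Fintype.not_linearIndependent_iff.1 hdep
  have hg : ∑ i, g i = 0 := by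
    have h := congrArg (inner ℝ x) hgv
    simp_rw [inner_sum, inner_smul_right, heq, ← Finset.sum_mul, inner_zero_right] at h
    exact (mul_eq_zero.1 h).resolve_right (by simpa using hx0)
  obtain ⟨a, k, hmem, hk⟩ := exists_mem_stdSimplex_sub_smul_apply_eq_zero (hW c) hg hg0
  refine hx0 (hzero _ hmem ?_ k hk)
  simp [sub_smul, mul_smul, Finset.sum_sub_distrib, ← Finset.smul_sum, hgv, ← hx]

/-- If the weighted sums of the points `(p i, 1)` over all classes of `c` agree, then the
convex hulls of the classes have a common point. -/
theorem iInter_convexHull_nonempty_of_sum_fiber_eq {ι κ E : Type*} [Fintype ι] [Fintype κ]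
    [DecidableEq κ] [Nonempty κ] [AddCommGroup E] [Module ℝ E] {p : ι → E} {c : ι → κ}
    {w : ι → ℝ} (hw : w ∈ stdSimplex ℝ ι) (b : ℝ) (S : E)
    (hb : ∀ s, ∑ i with c i = s, w i = b) (hS : ∀ s, ∑ i with c i = s, w i • p i = S) :
    (⋂ s, convexHull ℝ (p '' {i | c i = s})).Nonempty := by
  have hb0 : 0 < b := by
    have hsum : ∑ s, ∑ i with c i = s, w i = 1 := by rw [Finset.sum_fiberwise, hw.2]
    simp only [hb, Finset.sum_const, nsmul_eq_mul] at hsum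
    exact pos_of_mul_pos_right (hsum ▸ one_pos) (Nat.cast_nonneg _)
  refine ⟨b⁻¹ • S, Set.mem_iInter.2 fun s ↦ ?_⟩
  have hmem := Finset.centerMass_mem_convexHull (R := ℝ) (Finset.univ.filter fun i ↦ c i = s)
    (fun i _ ↦ hw.1 i) (by rwa [hb]) (z := p) (s := p '' {i | c i = s})
    fun i hi ↦ ⟨i, by simpa using hi, rfl⟩
  rwa [Finset.centerMass, hb, hS] at hmem

theorem exists_iInter_convexHull_nonempty_of_card {ι : Type*} [Fintype ι] (d m : ℕ)
    (hcard : (d + 1) * m < Fintype.card ι) (p : ι → EuclideanSpace ℝ (Fin d)) :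
    ∃ c : ι → Fin (m + 1), (⋂ s, convexHull ℝ (p '' {i | c i = s})).Nonempty := by
  let q : ι → Option (Fin d) → ℝ := fun i a ↦ a.elim 1 (p i)
  let u : Fin (m + 1) → Fin m → ℝ := fun j b ↦
    (if j = b.castSucc then 1 else 0) - (if j = Fin.last m then 1 else 0)
  let v : ι → Fin (m + 1) → EuclideanSpace ℝ (Option (Fin d) × Fin m) := fun i j ↦
    WithLp.toLp 2 fun ab ↦ q i ab.1 * u j ab.2
  obtain ⟨c, w, hw, hsum⟩ := exists_colorful_stdSimplex_sum_eq_zero (by simpa using hcard) v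
    (by
      intro i
      ext ab
      simp [v, u, ← Finset.mul_sum])
  have hq : ∀ a s, ∑ i with c i = s, w i * q i a = ∑ i with c i = Fin.last m, w i * q i a := by
    intro a s
    induction s using Fin.lastCases with
    | last => rfl
    | cast b =>
      have h := congrArg (fun z ↦ z.ofLp (a, b)) hsum
      simp only [v, u, WithLp.ofLp_sum, Finset.sum_apply, PiLp.smul_apply, smul_eq_mul, mul_sub,
        mul_ite, mul_one, mul_zero, Finset.sum_sub_distrib, PiLp.zero_apply, ← Finset.sum_filter,
        sub_eq_zero] at h
      exact h
  refine ⟨c, iInter_convexHull_nonempty_of_sum_fiber_eq hw (∑ i with c i = Fin.last m, w i)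
    (∑ i with c i = Fin.last m, w i • p i) (fun s ↦ ?_) fun s ↦ ?_⟩
  · simpa [q] using hq none s
  · ext a
    simpa [q] using hq (some a) s

/-- Tverberg theorem: for any `d, r > 0`, every `(d+1)(r-1)+1` pairwise distinct points
in `ℝ^d` can be decomposed into `r` disjoint groups whose convex hulls have a common
point. -/
theorem stmt_9 (d r : ℕ) (hd : 0 < d) (hr : 0 < r)
    (p : Fin ((d + 1) * (r - 1) + 1) → EuclideanSpace ℝ (Fin d))
    (hp : Function.Injective p) :
    ∃ c : Fin ((d + 1) * (r - 1) + 1) → Fin r,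
      (⋂ s : Fin r, convexHull ℝ (p '' {i | c i = s})).Nonempty := by
  obtain ⟨m, rfl⟩ := Nat.exists_eq_add_one.2 hr
  exact exists_iInter_convexHull_nonempty_of_card d m (by simp) p
end

section
/- (Linear van Kampen–Flores theorem.) For every positive integer k, from any 2k+3 pairwise distinct points in ℝ^{2k} one can choose two disjoint (k+1)-tuples whose convex hulls intersect: for every injective p : Fin (2k+3) → EuclideanSpace ℝ (Fin (2k)) there exist disjoint subsets A, B ⊆ Fin (2k+3) with |A| = |B| = k+1 such that convexHull ℝ (p '' A) ∩ convexHull ℝ (p '' B) is nonempty. -/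
open Finset in
/-- A subspace of `ℝⁿ` of dimension at least two contains a nonzero vector none of whose two
strict sign classes contains more than half of the coordinates. -/
theorem Submodule.exists_ne_zero_two_mul_card_sign_le {ι : Type*} [Fintype ι]
    (W : Submodule ℝ (ι → ℝ)) (hW : 1 < Module.finrank ℝ W) :
    ∃ w ∈ W, w ≠ 0 ∧ 2 * #{i | 0 < w i} ≤ Fintype.card ι ∧
      2 * #{i | w i < 0} ≤ Fintype.card ι := by
  by_contra! h
  let U : Set W := {w | Fintype.card ι < 2 * #{i | 0 < (w : ι → ℝ) i}}
  have hU : IsOpen U := by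
    rw [isOpen_iff_mem_nhds]
    intro w hw
    have hev : ∀ᶠ v : W in nhds w, ∀ i, 0 < (w : ι → ℝ) i → 0 < (v : ι → ℝ) i := by
      rw [Filter.eventually_all]
      intro i
      by_cases hi : 0 < (w : ι → ℝ) i
      · have hc : Continuous fun v : W ↦ (v : ι → ℝ) i :=
          (continuous_apply i).comp continuous_subtype_val
        filter_upwards [hc.continuousAt.eventually (lt_mem_nhds hi)] with v hv _ using hv
      · simp [hi]
    filter_upwards [hev] with v hv
    have hle : #{i | 0 < (w : ι → ℝ) i} ≤ #{i | 0 < (v : ι → ℝ) i} :=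
      card_le_card (monotone_filter_right _ fun i _ ↦ hv i)
    simp only [U, Set.mem_ofPred_eq] at hw ⊢
    omega
  have hneg : ∀ w : W, -w ∈ U ↔ Fintype.card ι < 2 * #{i | (w : ι → ℝ) i < 0} := by
    intro w
    simp [U]
  have hcover : ∀ w : W, w ≠ 0 → w ∈ U ∨ -w ∈ U := by
    intro w hw
    by_cases hwU : w ∈ U
    · exact Or.inl hwU
    · exact Or.inr ((hneg w).2 (h w w.2 (by simpa using hw) (not_lt.1 hwU)))
  have hconn : IsPreconnected ({0}ᶜ : Set W) :=
    (isConnected_compl_singleton_of_one_lt_rank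
      (by rw [← Module.finrank_eq_rank]; exact_mod_cast hW) 0).isPreconnected
  have : Nontrivial W := Module.nontrivial_of_finrank_pos (R := ℝ) (by omega)
  obtain ⟨w₀, hw₀⟩ := exists_ne (0 : W)
  obtain ⟨u, hu₀, hu⟩ : ∃ u : W, u ≠ 0 ∧ u ∈ U := by
    rcases hcover w₀ hw₀ with hw | hw
    · exact ⟨w₀, hw₀, hw⟩
    · exact ⟨-w₀, neg_ne_zero.2 hw₀, hw⟩
  obtain ⟨v, -, hv, hv'⟩ := hconn U (-U) hU hU.neg (fun w hw ↦ hcover w hw)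
    ⟨u, hu₀, hu⟩ ⟨-u, neg_ne_zero.2 hu₀, by simpa using hu⟩
  rw [Set.mem_neg, hneg] at hv'
  have hdisj : Disjoint (univ.filter fun i ↦ 0 < (v : ι → ℝ) i)
      (univ.filter fun i ↦ (v : ι → ℝ) i < 0) :=
    disjoint_filter.2 fun i _ h₁ h₂ ↦ lt_asymm h₁ h₂
  have hcard := card_le_univ (disjUnion _ _ hdisj)
  rw [card_disjUnion] at hcard
  simp only [U, Set.mem_ofPred_eq] at hv
  omega

open Finset in
/-- The convex hulls of the two sign classes of a nontrivial affine dependence intersect. -/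
theorem convexHull_inter_nonempty_of_affine_dependence {ι E : Type*} [Fintype ι]
    [AddCommGroup E] [Module ℝ E] {p : ι → E} {w : ι → ℝ} (hw : w ≠ 0)
    (hsum : ∑ i, w i = 0) (hp : ∑ i, w i • p i = 0) :
    (convexHull ℝ (p '' {i | 0 < w i}) ∩ convexHull ℝ (p '' {i | w i < 0})).Nonempty := by
  obtain ⟨j, hj⟩ : ∃ j, 0 < w j := by
    by_contra! h
    exact hw (funext fun i ↦
      (sum_eq_zero_iff_of_nonpos fun i _ ↦ h i).1 hsum i (mem_univ i))
  have hpos : 0 < ∑ i with 0 < w i, w i :=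
    sum_pos (fun i hi ↦ (mem_filter.1 hi).2) ⟨j, by simpa using hj⟩
  have hneg : ∑ i with w i < 0, w i + ∑ i with 0 ≤ w i, w i = 0 := by
    simpa only [hsum, not_lt] using sum_filter_add_sum_filter_not univ (fun i ↦ w i < 0) w
  have hsub : ({i | 0 < w i} : Finset ι) ⊆ ({i | 0 ≤ w i} : Finset ι) :=
    monotone_filter_right _ fun _ _ h ↦ le_of_lt h
  have hzero : ∀ i ∈ ({i | 0 ≤ w i} : Finset ι), i ∉ ({i | 0 < w i} : Finset ι) → w i = 0 := by
    intro i hi hi'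
    simp only [mem_filter, mem_univ, true_and, not_lt] at hi hi'
    exact le_antisymm hi' hi
  have heq : ({i | w i < 0} : Finset ι).centerMass w p =
      ({i | 0 < w i} : Finset ι).centerMass w p := by
    rw [centerMass_subset p hsub hzero]
    refine centerMass_of_sum_add_sum_eq_zero hneg ?_
    simpa only [hp, not_lt] using
      sum_filter_add_sum_filter_not univ (fun i ↦ w i < 0) fun i ↦ w i • p i
  refine ⟨({i | w i < 0} : Finset ι).centerMass w p, ?_, ?_⟩
  · rw [heq]
    exact centerMass_mem_convexHull _ (fun i hi ↦ (mem_filter.1 hi).2.le)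
      hpos fun i hi ↦ Set.mem_image_of_mem p (mem_filter.1 hi).2
  · exact centerMass_mem_convexHull_of_nonpos _ (fun i hi ↦ (mem_filter.1 hi).2.le)
      (by rw [sum_subset hsub hzero] at hpos; linarith) fun i hi ↦ Set.mem_image_of_mem p (mem_filter.1 hi).2

/-- Linear van Kampen–Flores theorem: from any `2k+3` pairwise distinct points in
`ℝ^{2k}` one can choose two disjoint `(k+1)`-tuples whose convex hulls intersect. -/
theorem stmt_10 (k : ℕ) (hk : 0 < k)
    (p : Fin (2 * k + 3) → EuclideanSpace ℝ (Fin (2 * k)))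
    (hp : Function.Injective p) :
    ∃ A B : Finset (Fin (2 * k + 3)), Disjoint A B ∧ A.card = k + 1 ∧ B.card = k + 1 ∧
      (convexHull ℝ (p '' A) ∩ convexHull ℝ (p '' B)).Nonempty := by
  let L : (Fin (2 * k + 3) → ℝ) →ₗ[ℝ] EuclideanSpace ℝ (Fin (2 * k)) × ℝ :=
    Fintype.linearCombination ℝ fun i ↦ (p i, 1)
  have hdim : 1 < Module.finrank ℝ (LinearMap.ker L) := by
    have h := L.finrank_range_add_finrank_ker
    have h' := (LinearMap.range L).finrank_le
    simp only [Module.finrank_prod, finrank_euclideanSpace, Module.finrank_self,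
      Module.finrank_fintype_fun_eq_card, Fintype.card_fin] at h h'
    omega
  obtain ⟨w, hwL, hw₀, hpos, hneg⟩ := Submodule.exists_ne_zero_two_mul_card_sign_le _ hdim
  rw [LinearMap.mem_ker, Fintype.linearCombination_apply, Prod.ext_iff] at hwL
  simp only [Prod.fst_sum, Prod.snd_sum, Prod.smul_fst, Prod.smul_snd, smul_eq_mul, mul_one,
    Prod.fst_zero, Prod.snd_zero] at hwL
  rw [Fintype.card_fin] at hpos hneg
  have hdisj : Disjoint (Finset.univ.filter fun i ↦ 0 < w i)
      (Finset.univ.filter fun i ↦ w i < 0) :=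
    Finset.disjoint_filter.2 fun i _ h₁ h₂ ↦ lt_asymm h₁ h₂
  obtain ⟨A, hA, hA', hAcard⟩ := Finset.exists_subsuperset_card_eq (n := k + 1)
    (Finset.subset_compl_iff_disjoint_right.2 hdisj) (by omega)
    (by rw [Finset.card_compl, Fintype.card_fin]; omega)
  obtain ⟨B, hB, hB', hBcard⟩ := Finset.exists_subsuperset_card_eq (n := k + 1)
    (Finset.subset_compl_comm.1 hA') (by omega)
    (by rw [Finset.card_compl, Fintype.card_fin]; omega)
  refine ⟨A, B, (Finset.subset_compl_iff_disjoint_left.1 hB'), hAcard, hBcard, ?_⟩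
  refine (convexHull_inter_nonempty_of_affine_dependence hw₀ hwL.2 hwL.1).mono
    (Set.inter_subset_inter (convexHull_mono (Set.image_mono fun i hi ↦ ?_))
      (convexHull_mono (Set.image_mono fun i hi ↦ ?_)))
  · exact hA (by simpa using hi)
  · exact hB (by simpa using hi)
end
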